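/- arXiv:2210.11812 — 2 statements merged into one kernel-verified Lean document; each statement's English description precedes it below -/
import Mathlib

section
/- Let d ≥ 3. There exists a constant C > 0 such that for every g ∈ L²(ℝ^d, (1+|v|) M(v) dv) satisfying the orthogonality conditions ∫ g M dv = 0, ∫ g v_i M dv = 0 for 1 ≤ i ≤ d, and ∫ g |v|² M dv = 0, the Dirichlet form D(g) := (1/4) ∫_{ℝ^d×ℝ^d×𝕊^{d−1}} M(v) M(v*) ((v−v*)·ω)_+ (Δg(v,v*,ω))² dv dv* dω satisfies D(g) ≥ C ∫_{ℝ^d} (1+|v|) g(v)² M(v) dv. -/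
open MeasureTheory Real Filter Topology
open scoped RealInnerProductSpace

noncomputable section

abbrev Rd (d : ℕ) := EuclideanSpace ℝ (Fin d)

/-- The unit sphere `𝕊^{d-1} ⊂ ℝ^d`. -/
abbrev Sph (d : ℕ) := Metric.sphere (0 : Rd d) 1

/-- The Maxwellian density on `ℝ^d`. -/
def Maxw (d : ℕ) (v : Rd d) : ℝ := (2 * π) ^ (-(d : ℝ) / 2) * Real.exp (-‖v‖ ^ 2 / 2)

/-- The scattered velocity `v' = v - ((v - v*)·ω) ω`. -/
def vOut (d : ℕ) (v vs : Rd d) (ω : Sph d) : Rd d :=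
  v - ⟪v - vs, (ω : Rd d)⟫ • (ω : Rd d)

/-- The scattered velocity `v*' = v* + ((v - v*)·ω) ω`. -/
def vsOut (d : ℕ) (v vs : Rd d) (ω : Sph d) : Rd d :=
  vs + ⟪v - vs, (ω : Rd d)⟫ • (ω : Rd d)

/-- `Δh(v, v*, ω) = h(v') + h(v*') - h(v) - h(v*)`. -/
def collDiff (d : ℕ) (h : Rd d → ℝ) (v vs : Rd d) (ω : Sph d) : ℝ :=
  h (vOut d v vs ω) + h (vsOut d v vs ω) - h v - h vs

/-- The uniform (rotation invariant) measure on the unit sphere, obtained from the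
Lebesgue measure by the polar decomposition. -/
def sphMeasure (d : ℕ) : Measure (Sph d) := (volume : Measure (Rd d)).toSphere

/-- The hard-sphere linearized Boltzmann collision operator
`(ℒg)(v) = ∫ M(v*) ((v-v*)·ω)₊ [g(v) + g(v*) - g(v') - g(v*')] dv* dω`. -/
def linL (d : ℕ) (g : Rd d → ℝ) (v : Rd d) : ℝ :=
  ∫ p : Rd d × Sph d,
    Maxw d p.1 * max ⟪v - p.1, (p.2 : Rd d)⟫ 0 * (-collDiff d g v p.1 p.2)
    ∂((volume : Measure (Rd d)).prod (sphMeasure d))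

end

noncomputable section

/-- The Dirichlet form of the hard-sphere linearized Boltzmann collision operator:
`D(g) = (1/4) ∫∫∫ M(v) M(v*) ((v-v*)·ω)₊ (Δg)² dv dv* dω`. -/
def dirichletForm (d : ℕ) (g : Rd d → ℝ) : ℝ :=
  (1 / 4) * ∫ p : (Rd d × Rd d) × Sph d,
    Maxw d p.1.1 * Maxw d p.1.2 * max ⟪p.1.1 - p.1.2, (p.2 : Rd d)⟫ 0
      * (collDiff d g p.1.1 p.1.2 p.2) ^ 2
    ∂(((volume : Measure (Rd d)).prod (volume : Measure (Rd d))).prod (sphMeasure d))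

namespace HardSphere
open ProbabilityTheory
open scoped ENNReal

/-- The standard Gaussian measure with density `Maxw`. -/
def gauss (d : ℕ) : Measure (Rd d) :=
  volume.withDensity fun v => ENNReal.ofReal (Maxw d v)

lemma maxw_pos (d : ℕ) (v : Rd d) : 0 < Maxw d v := by
  unfold Maxw; positivity

lemma continuous_maxw (d : ℕ) : Continuous (Maxw d) := by
  unfold Maxw; fun_prop

lemma integral_gauss {E : Type*} [NormedAddCommGroup E] [NormedSpace ℝ E] {d : ℕ} (F : Rd d → E) :
    ∫ v, F v ∂(gauss d) = ∫ v, Maxw d v • F v := by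
  rw [gauss, integral_withDensity_eq_integral_toReal_smul
    (continuous_maxw d).measurable.ennreal_ofReal (ae_of_all _ fun _ => ENNReal.ofReal_lt_top)]
  simp [ENNReal.toReal_ofReal (maxw_pos d _).le]

lemma integrable_gauss_iff {d : ℕ} (F : Rd d → ℝ) :
    Integrable F (gauss d) ↔ Integrable fun v => F v * Maxw d v := by
  rw [gauss, integrable_withDensity_iff (continuous_maxw d).measurable.ennreal_ofReal
    (ae_of_all _ fun _ => ENNReal.ofReal_lt_top)]
  simp [ENNReal.toReal_ofReal (maxw_pos d _).le]

lemma maxw_integral (d : ℕ) : ∫ v : Rd d, Maxw d v = 1 := by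
  have h := GaussianFourier.integral_rexp_neg_mul_sq_norm (V := Rd d) (b := 1 / 2) (by norm_num)
  simp only [Maxw]
  rw [integral_const_mul]
  have e : (fun v : Rd d => rexp (-‖v‖ ^ 2 / 2)) = fun v => rexp (-(1 / 2) * ‖v‖ ^ 2) := by
    ext v; congr 1; ring
  rw [e, h, finrank_euclideanSpace_fin, neg_div, Real.rpow_neg (by positivity)]
  have : π / (1 / 2) = 2 * π := by ring
  rw [this]
  exact inv_mul_cancel₀ (by positivity)

lemma maxw_integrable (d : ℕ) : Integrable (Maxw d) :=
  by_contra fun h => by simpa [integral_undef h] using maxw_integral d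

instance (d : ℕ) : IsProbabilityMeasure (gauss d) where
  measure_univ := by
    rw [gauss, withDensity_apply _ MeasurableSet.univ, Measure.restrict_univ,
      ← ofReal_integral_eq_lintegral_ofReal (maxw_integrable d)
        (ae_of_all _ fun v => (maxw_pos d v).le), maxw_integral, ENNReal.ofReal_one]

lemma gauss_eq_stdGaussian (d : ℕ) : gauss d = stdGaussian (Rd d) := by
  apply Measure.ext_of_charFun
  ext t
  rw [charFun_stdGaussian, charFun_apply, integral_gauss]
  have h := GaussianFourier.integral_cexp_neg_mul_sq_norm_add (V := Rd d) (b := 1 / 2)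
    (by norm_num) Complex.I t
  have e : ∀ v : Rd d, Maxw d v • Complex.exp (⟪v, t⟫ * Complex.I)
      = ((2 * π) ^ (-(d : ℝ) / 2) : ℝ) *
        Complex.exp (-(1 / 2) * ‖v‖ ^ 2 + Complex.I * ⟪t, v⟫) := by
    intro v
    rw [Complex.exp_add, Maxw, Complex.real_smul, real_inner_comm]
    push_cast
    rw [mul_assoc]
    congr 2
    · congr 1; ring
    · congr 1; ring
  simp_rw [e]
  rw [integral_const_mul, h, finrank_euclideanSpace_fin]
  have h1 : (π : ℂ) / (1 / 2) = ((2 * π : ℝ) : ℂ) := by push_cast; ring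
  rw [h1, ← mul_assoc]
  have h2 : ((d : ℂ) / 2) = ((d / 2 : ℝ) : ℂ) := by push_cast; rfl
  rw [h2, ← Complex.ofReal_cpow (by positivity), ← Complex.ofReal_mul, neg_div,
    Real.rpow_neg (by positivity), inv_mul_cancel₀ (by positivity), Complex.ofReal_one, one_mul]
  congr 1
  rw [Complex.I_sq]; ring

instance (d : ℕ) : IsGaussian (gauss d) := by
  rw [gauss_eq_stdGaussian]; infer_instance

lemma integrable_norm_pow (d k : ℕ) : Integrable (fun v => ‖v‖ ^ k) (gauss d) :=
  (IsGaussian.memLp_id (gauss d) k (by simp)).integrable_norm_pow'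

lemma integrable_one_add_norm_pow (d k : ℕ) : Integrable (fun v => (1 + ‖v‖) ^ k) (gauss d) := by
  simp_rw [add_comm (1 : ℝ), add_pow]
  exact integrable_finsetSum _ fun i _ => by
    simpa using (integrable_norm_pow d i).mul_const _

/-- The normalised exponential `v ↦ exp (a · v - |a|² / 2)`. -/
def expo {d : ℕ} (a v : Rd d) : ℝ := rexp (⟪a, v⟫ - ‖a‖ ^ 2 / 2)

lemma continuous_expo {d : ℕ} (a : Rd d) : Continuous (expo a) := by
  unfold expo; fun_prop

lemma expo_mul_maxw {d : ℕ} (a v : Rd d) : expo a v * Maxw d v = Maxw d (v - a) := by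
  unfold expo Maxw
  rw [mul_left_comm, ← Real.exp_add, norm_sub_sq_real, real_inner_comm]
  congr 2; ring

lemma integral_mul_expo {d : ℕ} (F : Rd d → ℝ) (a : Rd d) :
    ∫ v, F v * expo a v ∂(gauss d) = ∫ v, F (v + a) ∂(gauss d) := by
  rw [integral_gauss, integral_gauss, ← integral_add_right_eq_self _ a]
  congr 1; ext v
  rw [smul_eq_mul, smul_eq_mul, mul_left_comm, mul_comm (Maxw d _), expo_mul_maxw]
  simp [mul_comm]

lemma integrable_expo {d : ℕ} (a : Rd d) : Integrable (expo a) (gauss d) := by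
  rw [integrable_gauss_iff]
  simp_rw [expo_mul_maxw]
  exact (maxw_integrable d).comp_sub_right a

lemma integral_expo {d : ℕ} (a : Rd d) : ∫ v, expo a v ∂(gauss d) = 1 := by
  simpa using integral_mul_expo (fun _ => 1) a

lemma expo_mul_expo {d : ℕ} (a b v : Rd d) : expo a v * expo b v = rexp ⟪a, b⟫ * expo (a + b) v := by
  unfold expo
  rw [← Real.exp_add, ← Real.exp_add, inner_add_left, norm_add_sq_real]
  congr 1; ring

lemma integrable_expo_mul_expo {d : ℕ} (a b : Rd d) :
    Integrable (fun v => expo a v * expo b v) (gauss d) := by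
  simp_rw [expo_mul_expo]; exact (integrable_expo _).const_mul _

lemma integral_expo_mul_expo {d : ℕ} (a b : Rd d) :
    ∫ v, expo a v * expo b v ∂(gauss d) = rexp ⟪a, b⟫ := by
  simp_rw [expo_mul_expo]; rw [integral_const_mul, integral_expo, mul_one]

lemma memLp_expo {d : ℕ} (a : Rd d) : MemLp (expo a) 2 (gauss d) := by
  rw [memLp_two_iff_integrable_sq (continuous_expo a).aestronglyMeasurable]
  simp_rw [pow_two]
  exact integrable_expo_mul_expo a a

lemma integral_inner_gauss {d : ℕ} (a : Rd d) : ∫ v, ⟪a, v⟫ ∂(gauss d) = 0 := by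
  rw [gauss_eq_stdGaussian]
  exact integral_strongDual_stdGaussian (innerSL ℝ a)

lemma map_inner_gauss {d : ℕ} (ω : Sph d) :
    (gauss d).map (fun v => ⟪v, (ω : Rd d)⟫) = gaussianReal 0 1 := by
  have h := IsGaussian.map_eq_gaussianReal (μ := gauss d) (innerSL ℝ (ω : Rd d))
  have e : ⇑(innerSL ℝ (ω : Rd d)) = fun v => ⟪v, (ω : Rd d)⟫ := by
    ext v; simp [real_inner_comm]
  have hv : Var[fun v => ⟪v, (ω : Rd d)⟫; gauss d] = 1 := by
    rw [← e, gauss_eq_stdGaussian, variance_dual_stdGaussian, innerSL_apply_norm]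
    simp
  rw [e] at h
  have h0 : (gauss d)[fun v => ⟪v, (ω : Rd d)⟫] = 0 := by
    simp_rw [real_inner_comm (ω : Rd d)]; exact integral_inner_gauss _
  rw [h, h0, hv, Real.toNNReal_one]

lemma gauss_slab_le {d : ℕ} (ω : Sph d) (t ε : ℝ) :
    (gauss d).real {v | |t - ⟪v, (ω : Rd d)⟫| < ε} ≤ 2 * max ε 0 := by
  have hm : Measurable fun v : Rd d => ⟪v, (ω : Rd d)⟫ := by fun_prop
  have e : {v : Rd d | |t - ⟪v, (ω : Rd d)⟫| < ε}
      = (fun v => ⟪v, (ω : Rd d)⟫) ⁻¹' Metric.ball t ε := by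
    ext v; simp [Real.dist_eq, abs_sub_comm]
  rw [e, measureReal_def, ← Measure.map_apply hm measurableSet_ball, map_inner_gauss,
    gaussianReal_apply _ (by norm_num)]
  have h1 : ∫⁻ x in Metric.ball t ε, gaussianPDF 0 1 x ≤ ∫⁻ x in Metric.ball t ε, 1 := by
    refine lintegral_mono fun x => ?_
    rw [gaussianPDF, ENNReal.ofReal_le_one, gaussianPDFReal]
    have h3 : 1 ≤ √(2 * π * (1 : NNReal)) := by
      rw [Real.one_le_sqrt]; push_cast; nlinarith [Real.pi_gt_three]
    have h4 : rexp (-(x - 0) ^ 2 / (2 * (1 : NNReal))) ≤ 1 := by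
      rw [Real.exp_le_one_iff]
      have := sq_nonneg (x - 0)
      push_cast; linarith
    calc _ ≤ (1 : ℝ) * 1 := mul_le_mul (inv_le_one_of_one_le₀ h3) h4 (by positivity) (by norm_num)
      _ = 1 := by norm_num
  refine (ENNReal.toReal_mono ?_ h1).trans ?_
  · simp [ENNReal.mul_eq_top]
  · simp only [lintegral_one, Measure.restrict_apply_univ, Real.volume_ball]
    rw [ENNReal.toReal_ofReal']
    rcases le_total ε 0 with h | h
    · simp [h]; linarith
    · simp [h]

/-- For a fixed direction `ω`, the collision as a linear map on pairs of velocities. -/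
def collMap {d : ℕ} (ω : Rd d) : (Rd d × Rd d) →ₗ[ℝ] (Rd d × Rd d) where
  toFun p := (p.1 - ⟪p.1 - p.2, ω⟫ • ω, p.2 + ⟪p.1 - p.2, ω⟫ • ω)
  map_add' p q := by
    ext <;> simp [inner_sub_left, inner_add_left] <;> ring
  map_smul' c p := by
    ext <;> simp [inner_sub_left, inner_smul_left] <;> ring

lemma collMap_apply {d : ℕ} (ω : Sph d) (p : Rd d × Rd d) :
    collMap (ω : Rd d) p = (vOut d p.1 p.2 ω, vsOut d p.1 p.2 ω) := rfl

lemma inner_collMap {d : ℕ} (ω : Sph d) (p : Rd d × Rd d) :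
    ⟪(collMap (ω : Rd d) p).1 - (collMap (ω : Rd d) p).2, (ω : Rd d)⟫
      = -⟪p.1 - p.2, (ω : Rd d)⟫ := by
  have h : ⟪(ω : Rd d), (ω : Rd d)⟫ = 1 := by simp
  simp only [collMap, LinearMap.coe_mk, AddHom.coe_mk, inner_sub_left, inner_add_left,
    inner_smul_left, h]
  simp

lemma collMap_collMap {d : ℕ} (ω : Sph d) (p : Rd d × Rd d) :
    collMap (ω : Rd d) (collMap (ω : Rd d) p) = p := by
  have h := inner_collMap ω p
  simp only [collMap, LinearMap.coe_mk, AddHom.coe_mk] at h ⊢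
  rw [h]
  simp

lemma norm_sq_collMap {d : ℕ} (ω : Sph d) (p : Rd d × Rd d) :
    ‖(collMap (ω : Rd d) p).1‖ ^ 2 + ‖(collMap (ω : Rd d) p).2‖ ^ 2 = ‖p.1‖ ^ 2 + ‖p.2‖ ^ 2 := by
  have h : ‖(ω : Rd d)‖ = 1 := by simp
  simp only [collMap, LinearMap.coe_mk, AddHom.coe_mk, norm_sub_sq_real, norm_add_sq_real,
    inner_smul_right, norm_smul, h, inner_sub_left, Real.norm_eq_abs, mul_one, sq_abs]
  ring

lemma measurePreserving_collMap_volume {d : ℕ} (ω : Sph d) :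
    MeasurePreserving (collMap (ω : Rd d))
      ((volume : Measure (Rd d)).prod volume) ((volume : Measure (Rd d)).prod volume) := by
  have hc : collMap (ω : Rd d) ∘ₗ collMap (ω : Rd d) = LinearMap.id :=
    LinearMap.ext (collMap_collMap ω)
  have hd : LinearMap.det (collMap (ω : Rd d)) * LinearMap.det (collMap (ω : Rd d)) = 1 := by
    rw [← LinearMap.det_comp, hc, LinearMap.det_id]
  have hd0 : LinearMap.det (collMap (ω : Rd d)) ≠ 0 := fun h => by simp [h] at hd
  refine ⟨(LinearMap.continuous_of_finiteDimensional _).measurable, ?_⟩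
  rw [Measure.map_linearMap_addHaar_eq_smul_addHaar _ hd0]
  rcases mul_self_eq_one_iff.mp hd with h | h <;> simp [h]

lemma gauss_prod (d : ℕ) : (gauss d).prod (gauss d) =
    ((volume : Measure (Rd d)).prod volume).withDensity
      fun p => ENNReal.ofReal (Maxw d p.1 * Maxw d p.2) := by
  rw [gauss, prod_withDensity (continuous_maxw d).measurable.ennreal_ofReal
    (continuous_maxw d).measurable.ennreal_ofReal]
  congr 1; ext p
  rw [ENNReal.ofReal_mul (maxw_pos d _).le]

lemma maxw_mul_maxw {d : ℕ} (p : Rd d × Rd d) : Maxw d p.1 * Maxw d p.2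
    = ((2 * π) ^ (-(d : ℝ) / 2)) ^ 2 * rexp (-(‖p.1‖ ^ 2 + ‖p.2‖ ^ 2) / 2) := by
  unfold Maxw
  rw [mul_mul_mul_comm, ← Real.exp_add, ← sq,
    show -‖p.1‖ ^ 2 / 2 + -‖p.2‖ ^ 2 / 2 = -(‖p.1‖ ^ 2 + ‖p.2‖ ^ 2) / 2 by ring]

lemma measurePreserving_collMap {d : ℕ} (ω : Sph d) :
    MeasurePreserving (collMap (ω : Rd d))
      ((gauss d).prod (gauss d)) ((gauss d).prod (gauss d)) := by
  have hv := measurePreserving_collMap_volume ω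
  refine ⟨hv.measurable, ?_⟩
  have hρ : Measurable fun p : Rd d × Rd d => ENNReal.ofReal (Maxw d p.1 * Maxw d p.2) := by
    have := (continuous_maxw d).measurable
    fun_prop
  rw [gauss_prod]
  ext s hs
  rw [Measure.map_apply hv.measurable hs, withDensity_apply _ (hv.measurable hs),
    withDensity_apply _ hs, ← hv.setLIntegral_comp_preimage hs hρ]
  simp_rw [maxw_mul_maxw, norm_sq_collMap]

section Sphere
open scoped Pointwise

instance (d : ℕ) : IsFiniteMeasure (sphMeasure d) := by
  unfold sphMeasure; infer_instance

/-- The isometry of the unit sphere induced by a linear isometry. -/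
def sphRot {d : ℕ} (e : Rd d ≃ₗᵢ[ℝ] Rd d) (ω : Sph d) : Sph d :=
  ⟨e ω, by simp⟩

lemma measurePreserving_sphRot {d : ℕ} (e : Rd d ≃ₗᵢ[ℝ] Rd d) :
    MeasurePreserving (sphRot e) (sphMeasure d) (sphMeasure d) := by
  have hm : Measurable (sphRot e) :=
    (e.continuous.measurable.comp measurable_subtype_coe).subtype_mk
  refine ⟨hm, ?_⟩
  ext s hs
  rw [Measure.map_apply hm hs, sphMeasure, Measure.toSphere_apply' _ (hm hs),
    Measure.toSphere_apply' _ hs]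
  congr 1
  have h : Set.Ioo (0 : ℝ) 1 • ((↑) '' (sphRot e ⁻¹' s) : Set (Rd d))
      = e ⁻¹' (Set.Ioo (0 : ℝ) 1 • ((↑) '' s : Set (Rd d))) := by
    ext x
    simp only [Set.mem_smul, Set.mem_preimage, Set.mem_image]
    constructor
    · rintro ⟨r, hr, _, ⟨ω, hω, rfl⟩, rfl⟩
      exact ⟨r, hr, _, ⟨_, hω, rfl⟩, by simp [sphRot]⟩
    · rintro ⟨r, hr, _, ⟨ω, hω, rfl⟩, h⟩
      refine ⟨r, hr, _, ⟨sphRot e.symm ω, ?_, rfl⟩, ?_⟩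
      · simpa [sphRot] using hω
      · apply e.injective
        simp [sphRot, ← h]
  rw [h]
  exact e.measurePreserving.measure_preimage_emb e.toHomeomorph.measurableEmbedding _

/-- The uniform probability measure on the unit sphere. -/
def unif (d : ℕ) : Measure (Sph d) := (sphMeasure d Set.univ)⁻¹ • sphMeasure d

lemma sphMeasure_univ_ne_zero {d : ℕ} (hd : 0 < d) : sphMeasure d Set.univ ≠ 0 := by
  have : Nonempty (Fin d) := ⟨⟨0, hd⟩⟩
  rw [Ne, Measure.measure_univ_eq_zero]
  exact Measure.toSphere_ne_zero _

lemma isProbabilityMeasure_unif {d : ℕ} (hd : 0 < d) : IsProbabilityMeasure (unif d) where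
  measure_univ := by
    rw [unif, Measure.smul_apply, smul_eq_mul,
      ENNReal.inv_mul_cancel (sphMeasure_univ_ne_zero hd) (measure_ne_top _ _)]

instance (d : ℕ) : IsFiniteMeasure (unif d) := by
  rcases Nat.eq_zero_or_pos d with rfl | hd
  · have : IsEmpty (Sph 0) := ⟨fun ω => by
      have h := ω.2
      rw [Subsingleton.elim (ω : Rd 0) 0] at h
      simp at h⟩
    rw [Measure.eq_zero_of_isEmpty (unif 0)]
    infer_instance
  · have := isProbabilityMeasure_unif hd
    infer_instance

lemma sphMeasure_eq_smul_unif {d : ℕ} (hd : 0 < d) :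
    sphMeasure d = sphMeasure d Set.univ • unif d := by
  rw [unif, smul_smul, ENNReal.mul_inv_cancel (sphMeasure_univ_ne_zero hd) (measure_ne_top _ _),
    one_smul]

lemma integrable_unif {d : ℕ} {f : Sph d → ℝ} (hf : Continuous f) : Integrable f (unif d) :=
  hf.integrable_of_hasCompactSupport (HasCompactSupport.of_compactSpace f)

lemma integral_sphRot {d : ℕ} (e : Rd d ≃ₗᵢ[ℝ] Rd d) (f : Sph d → ℝ) :
    ∫ ω, f (sphRot e ω) ∂(unif d) = ∫ ω, f ω ∂(unif d) := by
  have he : MeasurableEmbedding (sphRot e) := by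
    refine MeasurableEquiv.measurableEmbedding
      ⟨⟨sphRot e, sphRot e.symm, fun ω => ?_, fun ω => ?_⟩, ?_, ?_⟩
    · ext1; simp [sphRot]
    · ext1; simp [sphRot]
    · exact (measurePreserving_sphRot e).measurable
    · exact (measurePreserving_sphRot e.symm).measurable
  rw [unif, integral_smul_measure, integral_smul_measure,
    (measurePreserving_sphRot e).integral_comp he]

lemma integral_inner_pow_eq_of_norm_eq {d : ℕ} {a b : Rd d} (h : ‖a‖ = ‖b‖) (k : ℕ) :
    ∫ ω : Sph d, ⟪a, (ω : Rd d)⟫ ^ k ∂(unif d) = ∫ ω : Sph d, ⟪b, (ω : Rd d)⟫ ^ k ∂(unif d) := by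
  let e := (ℝ ∙ (a - b))ᗮ.reflection
  have he : e a = b := Submodule.reflection_sub h
  rw [← integral_sphRot e (fun ω => ⟪b, (ω : Rd d)⟫ ^ k)]
  congr 1; ext ω
  rw [← he]; simp [sphRot]

lemma exists_integral_inner_pow (d k : ℕ) :
    ∃ C : ℝ, ∀ a : Rd d, ∫ ω : Sph d, ⟪a, (ω : Rd d)⟫ ^ k ∂(unif d) = C * ‖a‖ ^ k := by
  rcases Nat.eq_zero_or_pos d with rfl | hd
  · have : IsEmpty (Sph 0) := ⟨fun ω => by
      have h := ω.2
      rw [Subsingleton.elim (ω : Rd 0) 0] at h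
      simp at h⟩
    exact ⟨0, fun a => by simp [Measure.eq_zero_of_isEmpty (unif 0)]⟩
  · let e₀ : Rd d := EuclideanSpace.single ⟨0, hd⟩ 1
    refine ⟨∫ ω : Sph d, ⟪e₀, (ω : Rd d)⟫ ^ k ∂(unif d), fun a => ?_⟩
    rw [integral_inner_pow_eq_of_norm_eq (b := ‖a‖ • e₀) (by simp [norm_smul, e₀]),
      ← integral_mul_const]
    congr 1; ext ω
    rw [inner_smul_left, mul_pow]; simp [mul_comm]

lemma sum_inner_single_sq {d : ℕ} (a : Rd d) :
    ∑ i, ⟪EuclideanSpace.single i (1 : ℝ), a⟫ ^ 2 = ‖a‖ ^ 2 := by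
  simp [EuclideanSpace.norm_sq_eq, EuclideanSpace.inner_single_left]

lemma integral_inner_sq {d : ℕ} (hd : 0 < d) (a : Rd d) :
    ∫ ω : Sph d, ⟪a, (ω : Rd d)⟫ ^ 2 ∂(unif d) = ‖a‖ ^ 2 / d := by
  have := isProbabilityMeasure_unif hd
  obtain ⟨C, hC⟩ := exists_integral_inner_pow d 2
  have h : ∑ i : Fin d, ∫ ω : Sph d, ⟪EuclideanSpace.single i (1 : ℝ), (ω : Rd d)⟫ ^ 2 ∂(unif d)
      = 1 := by
    rw [← integral_finsetSum _ fun i _ => integrable_unif (by fun_prop)]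
    simp_rw [sum_inner_single_sq]
    simp
  simp_rw [hC] at h
  simp at h
  have hd' : (d : ℝ) ≠ 0 := by positivity
  rw [hC, eq_div_iff hd']
  linear_combination ‖a‖ ^ 2 * h

lemma integral_inner_mul_inner {d : ℕ} (hd : 0 < d) (a b : Rd d) :
    ∫ ω : Sph d, ⟪a, (ω : Rd d)⟫ * ⟪b, (ω : Rd d)⟫ ∂(unif d) = ⟪a, b⟫ / d := by
  have h1 : ∀ ω : Sph d, ⟪a, (ω : Rd d)⟫ * ⟪b, (ω : Rd d)⟫
      = (1 / 2) * (⟪a + b, (ω : Rd d)⟫ ^ 2 - ⟪a, (ω : Rd d)⟫ ^ 2 - ⟪b, (ω : Rd d)⟫ ^ 2) := by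
    intro ω; rw [inner_add_left]; ring
  simp_rw [h1]
  rw [integral_const_mul, integral_sub, integral_sub, integral_inner_sq hd, integral_inner_sq hd,
    integral_inner_sq hd, norm_add_sq_real]
  · ring
  all_goals exact integrable_unif (by fun_prop)

lemma integral_inner_sq_mul_inner_sq {d : ℕ} (hd : 0 < d) (a b : Rd d) :
    ∫ ω : Sph d, ⟪a, (ω : Rd d)⟫ ^ 2 * ⟪b, (ω : Rd d)⟫ ^ 2 ∂(unif d)
      = (‖a‖ ^ 2 * ‖b‖ ^ 2 + 2 * ⟪a, b⟫ ^ 2) / (d * (d + 2)) := by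
  obtain ⟨C, hC⟩ := exists_integral_inner_pow d 4
  have key : ∀ a b : Rd d, ∫ ω : Sph d, ⟪a, (ω : Rd d)⟫ ^ 2 * ⟪b, (ω : Rd d)⟫ ^ 2 ∂(unif d)
      = C / 3 * (‖a‖ ^ 2 * ‖b‖ ^ 2 + 2 * ⟪a, b⟫ ^ 2) := by
    intro a b
    have h1 : ∀ ω : Sph d, ⟪a, (ω : Rd d)⟫ ^ 2 * ⟪b, (ω : Rd d)⟫ ^ 2
        = (1 / 12) * (⟪a + b, (ω : Rd d)⟫ ^ 4 + ⟪a - b, (ω : Rd d)⟫ ^ 4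
          - 2 * ⟪a, (ω : Rd d)⟫ ^ 4 - 2 * ⟪b, (ω : Rd d)⟫ ^ 4) := by
      intro ω; rw [inner_add_left, inner_sub_left]; ring
    simp_rw [h1]
    rw [integral_const_mul, integral_sub, integral_sub, integral_add, integral_const_mul,
      integral_const_mul, hC, hC, hC, hC,
      show ‖a + b‖ ^ 4 = (‖a + b‖ ^ 2) ^ 2 by ring, show ‖a - b‖ ^ 4 = (‖a - b‖ ^ 2) ^ 2 by ring,
      norm_add_sq_real, norm_sub_sq_real]
    · ring
    all_goals exact integrable_unif (by fun_prop)
  have h := Finset.sum_congr rfl fun (i : Fin d) (_ : i ∈ Finset.univ) =>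
    key a (EuclideanSpace.single i (1 : ℝ))
  rw [← integral_finsetSum _ fun i _ => integrable_unif (by fun_prop)] at h
  simp_rw [← Finset.mul_sum, sum_inner_single_sq] at h
  simp only [norm_eq_of_mem_sphere, one_pow, mul_one, integral_inner_sq hd] at h
  rw [Finset.sum_add_distrib, ← Finset.mul_sum, ← Finset.mul_sum] at h
  have hs : ∑ i, ⟪a, EuclideanSpace.single i (1 : ℝ)⟫ ^ 2 = ‖a‖ ^ 2 := by
    rw [← sum_inner_single_sq]
    exact Finset.sum_congr rfl fun i _ => by rw [real_inner_comm]
  rw [hs] at h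
  simp at h
  have hd' : (d : ℝ) ≠ 0 := by positivity
  have hd2 : (d : ℝ) + 2 ≠ 0 := by positivity
  rcases eq_or_ne a 0 with rfl | ha
  · simp
  have hn : ‖a‖ ^ 2 ≠ 0 := by simpa using ha
  have hC' : C / 3 = 1 / (d * (d + 2)) := by
    rw [div_eq_iff hd'] at h
    rw [eq_div_iff (by positivity)]
    apply mul_left_cancel₀ hn
    linear_combination -h
  rw [key, hC']; ring

end Sphere

section Kernel
variable {α : Type*}

/-- The quadratic form of a kernel on finitely supported coefficients. -/
def kerForm (s : Finset α) (c : α → ℝ) (k : α → α → ℝ) : ℝ :=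
  ∑ i ∈ s, ∑ j ∈ s, c i * c j * k i j

/-- Positive semidefinite kernels (symmetry is not required). -/
def PSDKer (k : α → α → ℝ) : Prop := ∀ (s : Finset α) (c : α → ℝ), 0 ≤ kerForm s c k

/-- Kernels given by a finite feature map. -/
def FeatKer (k : α → α → ℝ) : Prop :=
  ∃ (ι : Type) (_ : Fintype ι) (φ : ι → α → ℝ), ∀ a b, k a b = ∑ t, φ t a * φ t b

lemma kerForm_add (s : Finset α) (c : α → ℝ) (k l : α → α → ℝ) :
    kerForm s c (fun a b => k a b + l a b) = kerForm s c k + kerForm s c l := by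
  simp [kerForm, mul_add, Finset.sum_add_distrib]

lemma kerForm_sub (s : Finset α) (c : α → ℝ) (k l : α → α → ℝ) :
    kerForm s c (fun a b => k a b - l a b) = kerForm s c k - kerForm s c l := by
  simp [kerForm, mul_sub, Finset.sum_sub_distrib]

lemma kerForm_const_mul (s : Finset α) (c : α → ℝ) (r : ℝ) (k : α → α → ℝ) :
    kerForm s c (fun a b => r * k a b) = r * kerForm s c k := by
  simp only [kerForm, Finset.mul_sum]
  exact Finset.sum_congr rfl fun _ _ => Finset.sum_congr rfl fun _ _ => by ring

lemma kerForm_mul_self (s : Finset α) (c φ : α → ℝ) :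
    kerForm s c (fun a b => φ a * φ b) = (∑ i ∈ s, c i * φ i) ^ 2 := by
  rw [sq, Finset.sum_mul_sum, kerForm]
  exact Finset.sum_congr rfl fun _ _ => Finset.sum_congr rfl fun _ _ => by ring

lemma PSDKer.feat_mul {h k : α → α → ℝ} (hk : PSDKer k) (hh : FeatKer h) :
    PSDKer fun a b => h a b * k a b := by
  obtain ⟨ι, _, φ, hφ⟩ := hh
  intro s c
  have e : kerForm s c (fun a b => h a b * k a b)
      = ∑ t, kerForm s (fun a => c a * φ t a) k := by
    simp only [kerForm]
    rw [Finset.sum_comm (s := Finset.univ) (t := s)]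
    refine Finset.sum_congr rfl fun i _ => ?_
    rw [Finset.sum_comm (s := Finset.univ) (t := s)]
    refine Finset.sum_congr rfl fun j _ => ?_
    rw [hφ, Finset.sum_mul, Finset.mul_sum]
    exact Finset.sum_congr rfl fun t _ => by ring
  rw [e]
  exact Finset.sum_nonneg fun t _ => hk _ _

lemma PSDKer.hasSum {k : ℕ → α → α → ℝ} {l : α → α → ℝ} (hk : ∀ n, PSDKer (k n))
    (h : ∀ a b, HasSum (fun n => k n a b) (l a b)) : PSDKer l := by
  intro s c
  have : HasSum (fun n => kerForm s c (k n)) (kerForm s c l) :=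
    hasSum_sum fun i _ => hasSum_sum fun j _ => (h i j).mul_left _
  exact this.nonneg fun n => hk n s c

lemma PSDKer.const_mul {k : α → α → ℝ} {r : ℝ} (hr : 0 ≤ r) (hk : PSDKer k) :
    PSDKer fun a b => r * k a b := fun s c => by
  rw [kerForm_const_mul]; exact mul_nonneg hr (hk s c)

lemma FeatKer.mul_self (φ : α → ℝ) : FeatKer fun a b => φ a * φ b :=
  ⟨Unit, inferInstance, fun _ => φ, fun a b => by simp⟩

lemma FeatKer.zero : FeatKer fun _ _ : α => 0 := by
  simpa using FeatKer.mul_self (fun _ : α => 0)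

lemma FeatKer.one : FeatKer fun _ _ : α => 1 := by
  simpa using FeatKer.mul_self (fun _ : α => 1)

lemma FeatKer.add {h k : α → α → ℝ} (hh : FeatKer h) (hk : FeatKer k) :
    FeatKer fun a b => h a b + k a b := by
  obtain ⟨ι, _, φ, hφ⟩ := hh
  obtain ⟨κ, _, ψ, hψ⟩ := hk
  exact ⟨ι ⊕ κ, inferInstance, Sum.elim φ ψ, fun a b => by simp [hφ, hψ]⟩

lemma FeatKer.mul {h k : α → α → ℝ} (hh : FeatKer h) (hk : FeatKer k) :
    FeatKer fun a b => h a b * k a b := by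
  obtain ⟨ι, _, φ, hφ⟩ := hh
  obtain ⟨κ, _, ψ, hψ⟩ := hk
  refine ⟨ι × κ, inferInstance, fun t a => φ t.1 a * ψ t.2 a, fun a b => ?_⟩
  beta_reduce
  rw [hφ, hψ, Finset.sum_mul_sum, Fintype.sum_prod_type]
  exact Finset.sum_congr rfl fun _ _ => Finset.sum_congr rfl fun _ _ => by ring

lemma FeatKer.pow {h : α → α → ℝ} (hh : FeatKer h) : ∀ n : ℕ, FeatKer fun a b => h a b ^ n
  | 0 => by simpa using FeatKer.one
  | n + 1 => by simpa only [pow_succ] using (hh.pow n).mul hh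

lemma FeatKer.psd {h : α → α → ℝ} (hh : FeatKer h) : PSDKer h := by
  have h1 : PSDKer fun _ _ : α => (1 : ℝ) := fun s c => by
    have := kerForm_mul_self s c fun _ => 1
    simp only [mul_one] at this
    rw [this]; positivity
  simpa using h1.feat_mul hh

lemma FeatKer.add_pow_sub {x y : α → α → ℝ} (hx : FeatKer x) (hy : FeatKer y) :
    ∀ n : ℕ, FeatKer fun a b => (x a b + y a b) ^ n - x a b ^ n
  | 0 => by simpa using FeatKer.zero
  | n + 1 => by
    have h := ((hx.add hy).mul (hx.add_pow_sub hy n)).add (hy.mul (hx.pow n))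
    convert h using 3
    ring

lemma FeatKer.add_pow_sub_sub {x y : α → α → ℝ} (hx : FeatKer x) (hy : FeatKer y) (n : ℕ) :
    FeatKer fun a b => (x a b + y a b) ^ (n + 2) - x a b ^ (n + 2) - y a b ^ (n + 2)
      - 2 * (x a b * y a b) * (x a b + y a b) ^ n := by
  have h := ((hx.pow 2).mul (hx.add_pow_sub hy n)).add ((hy.pow 2).mul (hy.add_pow_sub hx n))
  convert h using 3
  ring

end Kernel

/-- `∑ sᵐ / (m + 2)! = (eˢ - 1 - s) / s²`. -/
def expTail (s : ℝ) : ℝ := ∑' m : ℕ, s ^ m / (m + 2).factorial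

lemma hasSum_exp_sub (s : ℝ) :
    HasSum (fun m : ℕ => s ^ (m + 2) / (m + 2).factorial) (rexp s - 1 - s) := by
  have h : HasSum (fun n : ℕ => s ^ n / n.factorial) (rexp s) := by
    rw [Real.exp_eq_exp_ℝ]; exact NormedSpace.expSeries_div_hasSum_exp s
  have := (hasSum_nat_add_iff' 2).mpr h
  simpa [Finset.sum_range_succ, sub_sub] using this

lemma hasSum_expTail (s : ℝ) : HasSum (fun m : ℕ => s ^ m / (m + 2).factorial) (expTail s) := by
  refine Summable.hasSum (Summable.of_norm_bounded (g := fun m : ℕ => |s| ^ m / m.factorial)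
    (Real.summable_pow_div_factorial |s|) fun m => ?_)
  rw [norm_div, norm_pow, Real.norm_eq_abs, Real.norm_eq_abs, Nat.abs_cast]
  gcongr
  omega

lemma psdKer_exp_sub {α : Type*} {x y : α → α → ℝ} (hx : FeatKer x) (hy : FeatKer y) :
    PSDKer fun a b => (rexp (x a b) - 1) * (rexp (y a b) - 1)
      - 2 * (x a b * y a b) * expTail (x a b + y a b) := by
  refine PSDKer.hasSum (fun n => ((hx.add_pow_sub_sub hy n).psd.const_mul
    (r := 1 / ((n + 2).factorial : ℝ)) (by positivity))) fun a b => ?_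
  have h := (((hasSum_exp_sub (x a b + y a b)).sub (hasSum_exp_sub (x a b))).sub
    (hasSum_exp_sub (y a b))).sub ((hasSum_expTail (x a b + y a b)).mul_left
      (2 * (x a b * y a b)))
  have e : rexp (x a b + y a b) - 1 - (x a b + y a b) - (rexp (x a b) - 1 - x a b)
      - (rexp (y a b) - 1 - y a b) - 2 * (x a b * y a b) * expTail (x a b + y a b)
      = (rexp (x a b) - 1) * (rexp (y a b) - 1)
        - 2 * (x a b * y a b) * expTail (x a b + y a b) := by
    rw [Real.exp_add]; ring
  rw [e] at h
  have e' : (fun n : ℕ => 1 / ((n + 2).factorial : ℝ) * ((x a b + y a b) ^ (n + 2)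
      - x a b ^ (n + 2) - y a b ^ (n + 2) - 2 * (x a b * y a b) * (x a b + y a b) ^ n))
      = fun n : ℕ => (x a b + y a b) ^ (n + 2) / (n + 2).factorial
        - x a b ^ (n + 2) / (n + 2).factorial - y a b ^ (n + 2) / (n + 2).factorial
        - 2 * (x a b * y a b) * ((x a b + y a b) ^ n / (n + 2).factorial) := by
    ext n; ring
  rw [e']
  exact h

lemma featKer_inner (d : ℕ) : FeatKer fun a b : Rd d => ⟪a, b⟫ :=
  ⟨Fin d, inferInstance, fun i a => a i, fun a b => by
    simp [PiLp.inner_apply, mul_comm]⟩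

lemma featKer_inner_orth {d : ℕ} (ω : Sph d) :
    FeatKer fun a b : Rd d => ⟪a, b⟫ - ⟪a, (ω : Rd d)⟫ * ⟪b, (ω : Rd d)⟫ := by
  obtain ⟨ι, i, φ, hφ⟩ := featKer_inner d
  refine ⟨ι, i, fun t a => φ t (a - ⟪a, (ω : Rd d)⟫ • (ω : Rd d)), fun a b => ?_⟩
  rw [← hφ]
  have h : ⟪(ω : Rd d), (ω : Rd d)⟫ = 1 := by simp
  simp only [inner_sub_left, inner_sub_right, inner_smul_left, inner_smul_right, h,
    real_inner_comm (ω : Rd d)]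
  simp

/-- The kernel of the orthogonal projection of cubic forms onto harmonic ones. -/
lemma featKer_harmonic (d : ℕ) : FeatKer fun a b : Rd d =>
    ⟪a, b⟫ ^ 3 - 3 / (d + 2) * (‖a‖ ^ 2 * ‖b‖ ^ 2 * ⟪a, b⟫) := by
  refine ⟨Fin d × Fin d × Fin d, inferInstance, fun t a => a t.1 * a t.2.1 * a t.2.2
    - ‖a‖ ^ 2 / (d + 2) * (a t.1 * (if t.2.1 = t.2.2 then 1 else 0)
      + a t.2.1 * (if t.1 = t.2.2 then 1 else 0) + a t.2.2 * (if t.1 = t.2.1 then 1 else 0)),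
    fun a b => ?_⟩
  have hd2 : (d : ℝ) + 2 ≠ 0 := by positivity
  have hab : ⟪a, b⟫ = ∑ i, a i * b i := by simp [PiLp.inner_apply, mul_comm]
  have ha : ‖a‖ ^ 2 = ∑ i, a i * a i := by
    rw [EuclideanSpace.norm_sq_eq]; simp [sq]
  have hb : ‖b‖ ^ 2 = ∑ i, b i * b i := by
    rw [EuclideanSpace.norm_sq_eq]; simp [sq]
  set δ : Fin d → Fin d → ℝ := fun i j => if i = j then 1 else 0 with hδ
  let X : Rd d → Fin d × Fin d × Fin d → ℝ := fun a t => a t.1 * a t.2.1 * a t.2.2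
  let Y : Rd d → Fin d × Fin d × Fin d → ℝ := fun a t => a t.1 * δ t.2.1 t.2.2
    + a t.2.1 * δ t.1 t.2.2 + a t.2.2 * δ t.1 t.2.1
  have hXX : ∑ t, X a t * X b t = ⟪a, b⟫ ^ 3 := by
    rw [hab, pow_three, Finset.sum_mul_sum, Finset.sum_mul_sum, Fintype.sum_prod_type]
    simp only [Fintype.sum_prod_type, X, Finset.mul_sum]
    exact Finset.sum_congr rfl fun _ _ => Finset.sum_congr rfl fun _ _ =>
      Finset.sum_congr rfl fun _ _ => by ring
  have hXY : ∀ a b : Rd d, ∑ t, X a t * Y b t = 3 * (∑ i, a i * b i) * ∑ i, a i * a i := by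
    intro a b
    simp only [Fintype.sum_prod_type, X, Y, hδ, mul_add, mul_ite, mul_one, mul_zero,
      Finset.sum_add_distrib]
    simp only [Finset.sum_ite_eq, Finset.mem_univ, if_true,
      Finset.sum_ite_irrel, Finset.sum_const_zero]
    rw [mul_assoc, Finset.sum_mul_sum]
    rw [Finset.sum_comm (f := fun x y => a x * a y * a x * b y),
      Finset.sum_comm (f := fun x y => a x * a x * a y * b y)]
    simp only [Finset.mul_sum, ← Finset.sum_add_distrib]
    exact Finset.sum_congr rfl fun i _ => Finset.sum_congr rfl fun j _ => by ring
  have hYY : ∑ t, Y a t * Y b t = 3 * (d + 2) * ∑ i, a i * b i := by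
    simp only [Fintype.sum_prod_type, Y, hδ, mul_add, add_mul, mul_ite, ite_mul, zero_mul,
      mul_one, mul_zero,
      Finset.sum_add_distrib]
    simp [Finset.sum_add_distrib, ← Finset.mul_sum]
    ring
  have hYX : ∑ t, Y a t * X b t = 3 * (∑ i, a i * b i) * ∑ i, b i * b i := by
    have := hXY b a
    simpa only [mul_comm] using this
  have e : ∀ t, (X a t - ‖a‖ ^ 2 / (d + 2) * Y a t) * (X b t - ‖b‖ ^ 2 / (d + 2) * Y b t)
      = X a t * X b t - ‖b‖ ^ 2 / (d + 2) * (X a t * Y b t) - ‖a‖ ^ 2 / (d + 2) * (Y a t * X b t)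
        + ‖a‖ ^ 2 / (d + 2) * (‖b‖ ^ 2 / (d + 2)) * (Y a t * Y b t) := fun t => by ring
  change _ = ∑ t, (X a t - ‖a‖ ^ 2 / (d + 2) * Y a t) * (X b t - ‖b‖ ^ 2 / (d + 2) * Y b t)
  simp only [e, Finset.sum_add_distrib, Finset.sum_sub_distrib, ← Finset.mul_sum, hXX, hXY, hYX, hYY]
  rw [← hab, ← ha, ← hb]
  field_simp
  ring

/-- The comparison of power series behind the spectral gap for Maxwell molecules. -/
lemma psdKer_expTail (d : ℕ) : PSDKer fun a b : Rd d =>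
    (d * ⟪a, b⟫ ^ 2 - ‖a‖ ^ 2 * ‖b‖ ^ 2) * expTail ⟪a, b⟫
      - 2 * (d - 1) / 3 * (rexp ⟪a, b⟫ - 1 - ⟪a, b⟫) + ‖a‖ ^ 2 * ‖b‖ ^ 2 / 2 := by
  have hd2 : (d : ℝ) + 2 ≠ 0 := by positivity
  let k : ℕ → Rd d → Rd d → ℝ := fun n a b =>
    (d * ⟪a, b⟫ ^ 2 - ‖a‖ ^ 2 * ‖b‖ ^ 2) * (⟪a, b⟫ ^ n / (n + 2).factorial)
      - 2 * (d - 1) / 3 * (⟪a, b⟫ ^ (n + 2) / (n + 2).factorial)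
      + if n = 0 then ‖a‖ ^ 2 * ‖b‖ ^ 2 / 2 else 0
  refine PSDKer.hasSum (k := k) (fun n => ?_) fun a b =>
    (((hasSum_expTail _).mul_left _).sub ((hasSum_exp_sub _).mul_left _)).add (hasSum_ite_eq 0 _)
  rcases n with _ | m
  · have e : k 0 = fun a b : Rd d => ((d : ℝ) + 2) / 6 * ⟪a, b⟫ ^ 2 := by
      ext a b
      simp only [k]
      norm_num
      ring
    rw [e]
    exact ((featKer_inner d).pow 2).psd.const_mul (by positivity)
  · have e : k (m + 1) = fun a b : Rd d => ((d : ℝ) + 2) / 3 / (m + 1 + 2).factorial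
        * (⟪a, b⟫ ^ m * (⟪a, b⟫ ^ 3 - 3 / (d + 2) * (‖a‖ ^ 2 * ‖b‖ ^ 2 * ⟪a, b⟫))) := by
      ext a b
      simp only [k, Nat.succ_ne_zero, if_false]
      field_simp
      ring
    rw [e]
    exact (((featKer_inner d).pow m).mul (featKer_harmonic d)).psd.const_mul (by positivity)

/-- The Gram kernel of exponentials for the Maxwell collision operator. -/
def maxwellKer (d : ℕ) (a b : Rd d) : ℝ :=
  ∫ ω : Sph d, (rexp (⟪a, (ω : Rd d)⟫ * ⟪b, (ω : Rd d)⟫) - 1)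
    * (rexp (⟪a, b⟫ - ⟪a, (ω : Rd d)⟫ * ⟪b, (ω : Rd d)⟫) - 1) ∂unif d

lemma kerForm_maxwellKer_ge {d : ℕ} (hd : 0 < d) (s : Finset (Rd d)) (c : Rd d → ℝ) :
    2 / (d * (d + 2)) * (2 * (d - 1) / 3 * kerForm s c (fun a b => rexp ⟪a, b⟫ - 1 - ⟪a, b⟫)
      - 1 / 2 * kerForm s c (fun a b => ‖a‖ ^ 2 * ‖b‖ ^ 2)) ≤ kerForm s c (maxwellKer d) := by
  have hdpos : (0 : ℝ) < d := by exact_mod_cast hd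
  have := isProbabilityMeasure_unif hd
  have hpos := psdKer_expTail d s c
  rw [kerForm_add, kerForm_sub, kerForm_const_mul] at hpos
  have eN : kerForm s c (fun a b : Rd d => ‖a‖ ^ 2 * ‖b‖ ^ 2 / 2)
      = 1 / 2 * kerForm s c (fun a b => ‖a‖ ^ 2 * ‖b‖ ^ 2) := by
    rw [← kerForm_const_mul]; congr; ext a b; ring
  rw [eN] at hpos
  have hcomb : ∀ k : Sph d → Rd d → Rd d → ℝ, (∀ a b, Continuous fun ω => k ω a b) →
      Integrable (fun ω => kerForm s c (k ω)) (unif d) ∧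
      kerForm s c (fun a b => ∫ ω, k ω a b ∂unif d) = ∫ ω, kerForm s c (k ω) ∂unif d := by
    intro k hk
    have hi : ∀ a b, Integrable (fun ω => c a * c b * k ω a b) (unif d) := fun a b =>
      integrable_unif (continuous_const.mul (hk a b))
    refine ⟨integrable_finsetSum _ fun a _ => integrable_finsetSum _ fun b _ => hi a b, ?_⟩
    simp only [kerForm]
    rw [integral_finsetSum _ fun a _ => integrable_finsetSum _ fun b _ => hi a b]
    refine Finset.sum_congr rfl fun a _ => ?_
    rw [integral_finsetSum _ fun b _ => hi a b]
    exact Finset.sum_congr rfl fun b _ => (integral_const_mul _ _).symm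
  have h1 := hcomb (fun ω a b => (rexp (⟪a, (ω : Rd d)⟫ * ⟪b, (ω : Rd d)⟫) - 1)
    * (rexp (⟪a, b⟫ - ⟪a, (ω : Rd d)⟫ * ⟪b, (ω : Rd d)⟫) - 1)) fun a b => by fun_prop
  have h2 := hcomb (fun ω a b => 2 * ((⟪a, (ω : Rd d)⟫ * ⟪b, (ω : Rd d)⟫)
    * (⟪a, b⟫ - ⟪a, (ω : Rd d)⟫ * ⟪b, (ω : Rd d)⟫)) * expTail ⟪a, b⟫) fun a b => by fun_prop
  have h3 : (fun a b : Rd d => ∫ ω : Sph d, 2 * ((⟪a, (ω : Rd d)⟫ * ⟪b, (ω : Rd d)⟫)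
      * (⟪a, b⟫ - ⟪a, (ω : Rd d)⟫ * ⟪b, (ω : Rd d)⟫)) * expTail ⟪a, b⟫ ∂unif d)
      = fun a b => 2 / (d * (d + 2))
        * ((d * ⟪a, b⟫ ^ 2 - ‖a‖ ^ 2 * ‖b‖ ^ 2) * expTail ⟪a, b⟫) := by
    ext a b
    rw [integral_mul_const]
    have e : ∀ ω : Sph d, 2 * ((⟪a, (ω : Rd d)⟫ * ⟪b, (ω : Rd d)⟫)
        * (⟪a, b⟫ - ⟪a, (ω : Rd d)⟫ * ⟪b, (ω : Rd d)⟫))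
        = 2 * ⟪a, b⟫ * (⟪a, (ω : Rd d)⟫ * ⟪b, (ω : Rd d)⟫)
          - 2 * (⟪a, (ω : Rd d)⟫ ^ 2 * ⟪b, (ω : Rd d)⟫ ^ 2) := fun ω => by ring
    simp only [e]
    rw [integral_sub (integrable_unif (by fun_prop)) (integrable_unif (by fun_prop)),
      integral_const_mul, integral_const_mul, integral_inner_mul_inner hd,
      integral_inner_sq_mul_inner_sq hd]
    field_simp
    ring
  have h4 : ∫ ω, kerForm s c (fun a b => 2 * ((⟪a, ((ω : Sph d) : Rd d)⟫ * ⟪b, (ω : Rd d)⟫)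
      * (⟪a, b⟫ - ⟪a, (ω : Rd d)⟫ * ⟪b, (ω : Rd d)⟫)) * expTail ⟪a, b⟫) ∂unif d
      ≤ ∫ ω, kerForm s c (fun a b => (rexp (⟪a, ((ω : Sph d) : Rd d)⟫ * ⟪b, (ω : Rd d)⟫) - 1)
        * (rexp (⟪a, b⟫ - ⟪a, (ω : Rd d)⟫ * ⟪b, (ω : Rd d)⟫) - 1)) ∂unif d := by
    refine integral_mono h2.1 h1.1 fun ω => ?_
    have := psdKer_exp_sub (FeatKer.mul_self fun a : Rd d => ⟪a, (ω : Rd d)⟫)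
      (featKer_inner_orth ω) s c
    rw [kerForm_sub] at this
    simp only [add_sub_cancel] at this
    linarith
  rw [← h1.2, ← h2.2, h3, kerForm_const_mul] at h4
  refine le_trans ?_ h4
  gcongr
  linarith

/-- Collision configurations `(ω, (v, v*))`. -/
abbrev Coll (d : ℕ) := Sph d × (Rd d × Rd d)

/-- Uniform direction and independent Gaussian velocities. -/
def collMeasure (d : ℕ) : Measure (Coll d) := (unif d).prod ((gauss d).prod (gauss d))

instance (d : ℕ) : IsFiniteMeasure (collMeasure d) := by
  unfold collMeasure; infer_instance

/-- The joint exchange of incoming and outgoing velocities. -/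
def scatter {d : ℕ} (q : Coll d) : Coll d := (q.1, collMap (q.1 : Rd d) q.2)

/-- The exchange of the two particles. -/
def swapPair {d : ℕ} (q : Coll d) : Coll d := (q.1, q.2.swap)

lemma continuous_scatter {d : ℕ} : Continuous (scatter (d := d)) := by
  unfold scatter
  simp only [collMap_apply, vOut, vsOut]
  fun_prop

lemma measurePreserving_scatter (d : ℕ) :
    MeasurePreserving (scatter (d := d)) (collMeasure d) (collMeasure d) := by
  refine (MeasurePreserving.id (unif d)).skew_product
    (g := fun ω : Sph d => ⇑(collMap (ω : Rd d))) ?_ ?_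
  · exact (continuous_snd.comp continuous_scatter).measurable
  · exact ae_of_all _ fun ω => (measurePreserving_collMap ω).map_eq

lemma measurePreserving_swapPair (d : ℕ) :
    MeasurePreserving (swapPair (d := d)) (collMeasure d) (collMeasure d) :=
  (MeasurePreserving.id (unif d)).prod Measure.measurePreserving_swap

lemma scatter_scatter {d : ℕ} (q : Coll d) : scatter (scatter q) = q :=
  Prod.ext rfl (collMap_collMap q.1 q.2)

lemma measurePreserving_pre {d : ℕ} (hd : 0 < d) :
    MeasurePreserving (fun q : Coll d => q.2.1) (collMeasure d) (gauss d) := by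
  have := isProbabilityMeasure_unif hd
  exact measurePreserving_fst.comp (measurePreserving_snd (μ := unif d))

lemma measurePreserving_pre' {d : ℕ} (hd : 0 < d) :
    MeasurePreserving (fun q : Coll d => q.2.2) (collMeasure d) (gauss d) :=
  (measurePreserving_pre hd).comp (measurePreserving_swapPair d)

lemma measurePreserving_post {d : ℕ} (hd : 0 < d) :
    MeasurePreserving (fun q : Coll d => vOut d q.2.1 q.2.2 q.1) (collMeasure d) (gauss d) :=
  (measurePreserving_pre hd).comp (measurePreserving_scatter d)

lemma measurePreserving_post' {d : ℕ} (hd : 0 < d) :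
    MeasurePreserving (fun q : Coll d => vsOut d q.2.1 q.2.2 q.1) (collMeasure d) (gauss d) :=
  (measurePreserving_pre' hd).comp (measurePreserving_scatter d)

/-- The collision difference as a function on configurations. -/
def diff {d : ℕ} (g : Rd d → ℝ) (q : Coll d) : ℝ := collDiff d g q.2.1 q.2.2 q.1

/-- The collision difference as an operator between `L²` spaces. -/
def diffOp {d : ℕ} (hd : 0 < d) : Lp ℝ 2 (gauss d) →L[ℝ] Lp ℝ 2 (collMeasure d) :=
  (Lp.compMeasurePreservingₗᵢ ℝ _ (measurePreserving_post hd)).toContinuousLinearMap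
    + (Lp.compMeasurePreservingₗᵢ ℝ _ (measurePreserving_post' hd)).toContinuousLinearMap
    - (Lp.compMeasurePreservingₗᵢ ℝ _ (measurePreserving_pre hd)).toContinuousLinearMap
    - (Lp.compMeasurePreservingₗᵢ ℝ _ (measurePreserving_pre' hd)).toContinuousLinearMap

lemma memLp_diff {d : ℕ} (hd : 0 < d) {g : Rd d → ℝ} (hg : MemLp g 2 (gauss d)) :
    MemLp (diff g) 2 (collMeasure d) :=
  (((hg.comp_measurePreserving (measurePreserving_post hd)).add
    (hg.comp_measurePreserving (measurePreserving_post' hd))).sub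
    (hg.comp_measurePreserving (measurePreserving_pre hd))).sub
    (hg.comp_measurePreserving (measurePreserving_pre' hd))

lemma diffOp_toLp {d : ℕ} (hd : 0 < d) {g : Rd d → ℝ} (hg : MemLp g 2 (gauss d)) :
    diffOp hd (hg.toLp g) = (memLp_diff hd hg).toLp (diff g) := rfl

lemma inner_toLp {α : Type*} [MeasurableSpace α] {μ : Measure α} {f g : α → ℝ}
    (hf : MemLp f 2 μ) (hg : MemLp g 2 μ) : ⟪hf.toLp f, hg.toLp g⟫ = ∫ x, f x * g x ∂μ := by
  rw [L2.inner_def]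
  refine integral_congr_ae ?_
  filter_upwards [hf.coeFn_toLp, hg.coeFn_toLp] with x h1 h2
  simp [h1, h2, mul_comm]

lemma norm_sq_toLp {α : Type*} [MeasurableSpace α] {μ : Measure α} {f : α → ℝ}
    (hf : MemLp f 2 μ) : ‖hf.toLp f‖ ^ 2 = ∫ x, f x ^ 2 ∂μ := by
  rw [← real_inner_self_eq_norm_sq, inner_toLp]
  simp only [sq]

lemma integral_expo_prod {d : ℕ} (a b : Rd d × Rd d) :
    Integrable (fun p : Rd d × Rd d => (expo a.1 p.1 * expo a.2 p.2) * (expo b.1 p.1 * expo b.2 p.2))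
      ((gauss d).prod (gauss d)) ∧
    ∫ p : Rd d × Rd d, (expo a.1 p.1 * expo a.2 p.2) * (expo b.1 p.1 * expo b.2 p.2)
      ∂((gauss d).prod (gauss d)) = rexp (⟪a.1, b.1⟫ + ⟪a.2, b.2⟫) := by
  simp only [mul_mul_mul_comm (expo a.1 _)]
  refine ⟨(integrable_expo_mul_expo a.1 b.1).mul_prod (integrable_expo_mul_expo a.2 b.2), ?_⟩
  rw [integral_prod_mul (fun v => expo a.1 v * expo b.1 v) (fun v => expo a.2 v * expo b.2 v),
    integral_expo_mul_expo, integral_expo_mul_expo, Real.exp_add]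

lemma diff_expo {d : ℕ} (a : Rd d) (ω : Sph d) (p : Rd d × Rd d) :
    diff (expo a) (ω, p) = ∑ i : Fin 4, (![1, 1, -1, -1] i : ℝ) *
      (expo (![a - ⟪a, (ω : Rd d)⟫ • (ω : Rd d), ⟪a, (ω : Rd d)⟫ • (ω : Rd d), a, 0] i) p.1 *
        expo (![⟪a, (ω : Rd d)⟫ • (ω : Rd d), a - ⟪a, (ω : Rd d)⟫ • (ω : Rd d), 0, a] i) p.2) := by
  have h : ⟪(ω : Rd d), (ω : Rd d)⟫ = 1 := by simp
  have h' : ‖(ω : Rd d)‖ = 1 := by simp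
  have h0 : ∀ v : Rd d, expo 0 v = 1 := fun v => by simp [expo]
  have h1 : expo a (vOut d p.1 p.2 ω) = expo (a - ⟪a, (ω : Rd d)⟫ • (ω : Rd d)) p.1
      * expo (⟪a, (ω : Rd d)⟫ • (ω : Rd d)) p.2 := by
    simp only [expo, vOut]
    rw [← Real.exp_add]
    congr 1
    simp only [inner_sub_left, inner_sub_right, inner_smul_left, inner_smul_right, norm_sub_sq_real,
      norm_smul, h', real_inner_comm (ω : Rd d)]
    simp
    ring
  have h2 : expo a (vsOut d p.1 p.2 ω) = expo (⟪a, (ω : Rd d)⟫ • (ω : Rd d)) p.1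
      * expo (a - ⟪a, (ω : Rd d)⟫ • (ω : Rd d)) p.2 := by
    simp only [expo, vsOut]
    rw [← Real.exp_add]
    congr 1
    simp only [inner_sub_left, inner_sub_right, inner_add_right, inner_smul_left, inner_smul_right,
      norm_sub_sq_real, norm_smul, h', real_inner_comm (ω : Rd d)]
    simp
    ring
  simp only [diff, collDiff, Fin.sum_univ_four]
  simp [h0, h1, h2]
  ring

lemma integral_diff_expo {d : ℕ} (a b : Rd d) (ω : Sph d) :
    ∫ p, diff (expo a) (ω, p) * diff (expo b) (ω, p) ∂((gauss d).prod (gauss d))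
      = 4 * ((rexp (⟪a, (ω : Rd d)⟫ * ⟪b, (ω : Rd d)⟫) - 1)
        * (rexp (⟪a, b⟫ - ⟪a, (ω : Rd d)⟫ * ⟪b, (ω : Rd d)⟫) - 1)) := by
  have h : ⟪(ω : Rd d), (ω : Rd d)⟫ = 1 := by simp
  simp only [diff_expo, Finset.sum_mul_sum, mul_mul_mul_comm (_ : ℝ) (_ * _ : ℝ)]
  rw [integral_finsetSum _ fun i _ => integrable_finsetSum _ fun j _ =>
    (integral_expo_prod (_, _) (_, _)).1.const_mul _]
  simp_rw [integral_finsetSum _ fun j _ => (integral_expo_prod (_, _) (_, _)).1.const_mul _,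
    integral_const_mul]
  simp_rw [(integral_expo_prod (_, _) (_, _)).2]
  have hE : rexp ⟪a, b⟫ = rexp (⟪a, (ω : Rd d)⟫ * ⟪b, (ω : Rd d)⟫)
      * rexp (⟪a, b⟫ - ⟪a, (ω : Rd d)⟫ * ⟪b, (ω : Rd d)⟫) := by
    rw [← Real.exp_add]; congr 1; ring
  have i1 : ⟪a - ⟪a, (ω : Rd d)⟫ • (ω : Rd d), b - ⟪b, (ω : Rd d)⟫ • (ω : Rd d)⟫
      = ⟪a, b⟫ - ⟪a, (ω : Rd d)⟫ * ⟪b, (ω : Rd d)⟫ := by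
    simp only [inner_sub_left, inner_sub_right, inner_smul_left, inner_smul_right, h,
      real_inner_comm (ω : Rd d)]
    simp
  have i2 : ⟪a - ⟪a, (ω : Rd d)⟫ • (ω : Rd d), ⟪b, (ω : Rd d)⟫ • (ω : Rd d)⟫ = 0 := by
    simp only [inner_smul_right, inner_sub_left, inner_smul_left, h]
    simp
  have i3 : ⟪⟪a, (ω : Rd d)⟫ • (ω : Rd d), b - ⟪b, (ω : Rd d)⟫ • (ω : Rd d)⟫ = 0 := by
    simp only [inner_sub_right, inner_smul_left, inner_smul_right, h, real_inner_comm (ω : Rd d)]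
    simp [mul_comm]
  have i4 : ⟪⟪a, (ω : Rd d)⟫ • (ω : Rd d), ⟪b, (ω : Rd d)⟫ • (ω : Rd d)⟫
      = ⟪a, (ω : Rd d)⟫ * ⟪b, (ω : Rd d)⟫ := by
    simp only [inner_smul_right, h, real_inner_comm (ω : Rd d)]
    simp [mul_comm]
  have i5 : ⟪a - ⟪a, (ω : Rd d)⟫ • (ω : Rd d), b⟫
      = ⟪a, b⟫ - ⟪a, (ω : Rd d)⟫ * ⟪b, (ω : Rd d)⟫ := by
    simp only [inner_sub_left, inner_smul_left, real_inner_comm (ω : Rd d)]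
    simp
  have i6 : ⟪a, b - ⟪b, (ω : Rd d)⟫ • (ω : Rd d)⟫
      = ⟪a, b⟫ - ⟪a, (ω : Rd d)⟫ * ⟪b, (ω : Rd d)⟫ := by
    simp only [inner_sub_right, inner_smul_right]
    ring
  have i7 : ⟪⟪a, (ω : Rd d)⟫ • (ω : Rd d), b⟫ = ⟪a, (ω : Rd d)⟫ * ⟪b, (ω : Rd d)⟫ := by
    simp only [inner_smul_left, real_inner_comm (ω : Rd d)]
    simp
  have i8 : ⟪a, ⟪b, (ω : Rd d)⟫ • (ω : Rd d)⟫ = ⟪a, (ω : Rd d)⟫ * ⟪b, (ω : Rd d)⟫ := by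
    simp only [inner_smul_right]
    ring
  simp only [Fin.sum_univ_four, Matrix.cons_val, i1, i2, i3, i4, i5, i6, i7, i8, inner_zero_left,
    inner_zero_right, add_zero, zero_add, Real.exp_zero, hE, sub_add_cancel, add_sub_cancel]
  ring

/-- The Gram matrix of the exponentials under the collision difference. -/
lemma inner_diffOp_expo {d : ℕ} (hd : 0 < d) (a b : Rd d) :
    ⟪diffOp hd ((memLp_expo a).toLp _), diffOp hd ((memLp_expo b).toLp _)⟫
      = 4 * maxwellKer d a b := by
  rw [diffOp_toLp, diffOp_toLp, inner_toLp, collMeasure, integral_prod]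
  · simp only [integral_diff_expo, integral_const_mul]
    rfl
  · exact (memLp_diff hd (memLp_expo a)).integrable_mul (memLp_diff hd (memLp_expo b))

lemma ext_of_integral_exp {d : ℕ} {μ ν : Measure (Rd d)} [IsFiniteMeasure μ] [IsFiniteMeasure ν]
    (hi : ∀ t, Integrable (fun v => rexp ⟪v, t⟫) μ)
    (h : ∀ t, ∫ v, rexp ⟪v, t⟫ ∂μ = ∫ v, rexp ⟪v, t⟫ ∂ν) : μ = ν := by
  have hz : μ = 0 ↔ ν = 0 := by
    have h0 := h 0
    simp only [inner_zero_right, Real.exp_zero, integral_const, smul_eq_mul, mul_one] at h0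
    rw [← Measure.measure_univ_eq_zero, ← Measure.measure_univ_eq_zero,
      ← measureReal_eq_zero_iff, ← measureReal_eq_zero_iff, h0]
  refine Measure.ext_of_charFun (funext fun t => ?_)
  have hmgf : mgf (fun v => ⟪v, t⟫) μ = mgf (fun v => ⟪v, t⟫) ν := by
    ext s
    simpa [mgf, inner_smul_right] using h (s • t)
  have huniv : integrableExpSet (fun v => ⟪v, t⟫) μ = Set.univ := by
    ext s
    simpa [integrableExpSet, inner_smul_right] using hi (s • t)
  have := eqOn_complexMGF_of_mgf' hmgf hz (x := Complex.I) (by simp [huniv])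
  simpa [complexMGF, charFun_apply, mul_comm] using this

lemma ae_eq_zero_of_integral_expo {d : ℕ} {h : Rd d → ℝ} (hm : Measurable h)
    (h2 : MemLp h 2 (gauss d)) (h0 : ∀ a, ∫ v, expo a v * h v ∂(gauss d) = 0) :
    h =ᵐ[gauss d] 0 := by
  have hpm : ∀ x : ℝ, max x 0 - max (-x) 0 = x := fun x => by
    rcases le_total x 0 with hx | hx <;> simp [hx]
  have hexp : ∀ a, ∀ f : Rd d → ℝ, MemLp f 2 (gauss d) →
      Integrable (fun v => rexp ⟪v, a⟫ * f v) (gauss d) := fun a f hf => by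
    have := ((memLp_expo a).integrable_mul hf).const_mul (rexp (‖a‖ ^ 2 / 2))
    refine this.congr (ae_of_all _ fun v => ?_)
    simp only [expo, Pi.mul_apply]
    rw [← mul_assoc, ← Real.exp_add, real_inner_comm]
    congr 2; ring
  have key : ∀ f : Rd d → ℝ, Measurable f → MemLp f 2 (gauss d) →
      IsFiniteMeasure ((gauss d).withDensity fun v => ENNReal.ofReal (f v)) ∧ ∀ t,
      Integrable (fun v => rexp ⟪v, t⟫) ((gauss d).withDensity fun v => ENNReal.ofReal (f v)) ∧
      ∫ v, rexp ⟪v, t⟫ ∂((gauss d).withDensity fun v => ENNReal.ofReal (f v))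
        = ∫ v, rexp ⟪v, t⟫ * max (f v) 0 ∂(gauss d) := by
    intro f hf hf2
    refine ⟨isFiniteMeasure_withDensity_ofReal (hf2.integrable (by norm_num)).2, fun t => ⟨?_, ?_⟩⟩
    · rw [integrable_withDensity_iff hf.ennreal_ofReal (ae_of_all _ fun _ => ENNReal.ofReal_lt_top)]
      simp only [ENNReal.toReal_ofReal']
      exact hexp t _ hf2.pos_part
    · rw [integral_withDensity_eq_integral_toReal_smul hf.ennreal_ofReal
        (ae_of_all _ fun _ => ENNReal.ofReal_lt_top)]
      simp only [ENNReal.toReal_ofReal', smul_eq_mul, mul_comm]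
  obtain ⟨hf1, k1⟩ := key h hm h2
  have hm' : Measurable fun v => -h v := hm.neg
  have h2' : MemLp (fun v => -h v) 2 (gauss d) := h2.neg
  obtain ⟨hf2, k2⟩ := key (fun v => -h v) hm' h2'
  have e : ((gauss d).withDensity fun v => ENNReal.ofReal (h v))
      = (gauss d).withDensity fun v => ENNReal.ofReal (-h v) := by
    refine ext_of_integral_exp (fun t => (k1 t).1) fun t => ?_
    rw [(k1 t).2, (k2 t).2, ← sub_eq_zero, ← integral_sub (hexp t _ h2.pos_part)
      (hexp t _ h2'.pos_part)]
    have : ∀ v, rexp ⟪v, t⟫ * max (h v) 0 - rexp ⟪v, t⟫ * max (-h v) 0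
        = rexp (‖t‖ ^ 2 / 2) * (expo t v * h v) := fun v => by
      rw [expo, ← mul_assoc, ← Real.exp_add, real_inner_comm, ← mul_sub]
      congr 1
      · congr 1; ring
      · exact hpm _
    simp only [this]
    rw [integral_const_mul, h0, mul_zero]
  rw [withDensity_eq_iff hm.ennreal_ofReal.aemeasurable hm'.ennreal_ofReal.aemeasurable] at e
  · filter_upwards [e] with v hv
    have h3 := congrArg ENNReal.toReal hv
    simp only [ENNReal.toReal_ofReal'] at h3
    have := hpm (h v)
    simp only [Pi.zero_apply]
    linarith
  · have := hf1.measure_univ_lt_top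
    rw [withDensity_apply _ MeasurableSet.univ, Measure.restrict_univ] at this
    exact this.ne

/-- The normalised exponential as an `L²` vector. -/
def expoL {d : ℕ} (a : Rd d) : Lp ℝ 2 (gauss d) := (memLp_expo a).toLp _

lemma topologicalClosure_span_expoL (d : ℕ) :
    (Submodule.span ℝ (Set.range (expoL (d := d)))).topologicalClosure = ⊤ := by
  rw [Submodule.topologicalClosure_eq_top_iff, Submodule.eq_bot_iff]
  intro f hf
  rw [Lp.eq_zero_iff_ae_eq_zero]
  refine ae_eq_zero_of_integral_expo (Lp.stronglyMeasurable f).measurable (Lp.memLp f) fun a => ?_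
  have h := (Submodule.mem_orthogonal _ _).mp hf (expoL a) (Submodule.subset_span ⟨a, rfl⟩)
  rw [← Lp.toLp_coeFn f (Lp.memLp f), expoL, inner_toLp] at h
  exact h

lemma norm_sq_sum_eq_kerForm {α E : Type*} [NormedAddCommGroup E] [InnerProductSpace ℝ E]
    (s : Finset α) (c : α → ℝ) (x : α → E) :
    ‖∑ a ∈ s, c a • x a‖ ^ 2 = kerForm s c fun a b => ⟪x a, x b⟫ := by
  rw [← real_inner_self_eq_norm_sq, sum_inner, kerForm]
  refine Finset.sum_congr rfl fun a _ => ?_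
  rw [inner_sum]
  refine Finset.sum_congr rfl fun b _ => ?_
  rw [real_inner_smul_left, real_inner_smul_right]; ring

lemma inner_sum_sq_eq_kerForm {α E : Type*} [NormedAddCommGroup E] [InnerProductSpace ℝ E]
    (s : Finset α) (c : α → ℝ) (x : α → E) (y : E) :
    ⟪∑ a ∈ s, c a • x a, y⟫ ^ 2 = kerForm s c fun a b => ⟪x a, y⟫ * ⟪x b, y⟫ := by
  rw [kerForm_mul_self, sum_inner]
  simp only [real_inner_smul_left]

lemma memLp_norm_sq (d : ℕ) : MemLp (fun v : Rd d => ‖v‖ ^ 2) 2 (gauss d) := by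
  rw [memLp_two_iff_integrable_sq (by fun_prop)]
  simpa only [← pow_mul] using integrable_norm_pow d 4

lemma memLp_coord {d : ℕ} (i : Fin d) : MemLp (fun v : Rd d => v i) 2 (gauss d) := by
  rw [memLp_two_iff_integrable_sq (by fun_prop)]
  refine (integrable_norm_pow d 2).mono' (by fun_prop) (ae_of_all _ fun v => ?_)
  rw [norm_pow]
  gcongr
  exact PiLp.norm_apply_le v i

/-- The second moment of the Gaussian. -/
def gaussEnergy (d : ℕ) : ℝ := ∫ v, ‖v‖ ^ 2 ∂(gauss d)

/-- The coordinate functions as `L²` vectors. -/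
def coordL {d : ℕ} (i : Fin d) : Lp ℝ 2 (gauss d) := (memLp_coord i).toLp _

lemma memLp_energy (d : ℕ) : MemLp (fun v : Rd d => ‖v‖ ^ 2 - gaussEnergy d) 2 (gauss d) :=
  (memLp_norm_sq d).sub (memLp_const _)

/-- The centred energy as an `L²` vector. -/
def energyL (d : ℕ) : Lp ℝ 2 (gauss d) := (memLp_energy d).toLp _

lemma inner_expoL_expoL {d : ℕ} (a b : Rd d) : ⟪expoL a, expoL b⟫ = rexp ⟪a, b⟫ := by
  rw [expoL, expoL, inner_toLp, integral_expo_mul_expo]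

lemma inner_expoL_coordL {d : ℕ} (a : Rd d) (i : Fin d) : ⟪expoL a, coordL i⟫ = a i := by
  have h : ∫ v : Rd d, v i ∂(gauss d) = 0 := by
    simpa [EuclideanSpace.inner_single_left] using
      integral_inner_gauss (EuclideanSpace.single i (1 : ℝ))
  rw [expoL, coordL, inner_toLp]
  simp_rw [mul_comm (expo a _)]
  rw [integral_mul_expo (fun v => v i)]
  simp only [PiLp.add_apply]
  rw [integral_add ((memLp_coord i).integrable (by norm_num)) (integrable_const _), h]
  simp

lemma inner_expoL_energyL {d : ℕ} (a : Rd d) : ⟪expoL a, energyL d⟫ = ‖a‖ ^ 2 := by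
  rw [expoL, energyL, inner_toLp]
  simp_rw [mul_comm (expo a _)]
  rw [integral_mul_expo (fun v => ‖v‖ ^ 2 - gaussEnergy d)]
  have e : ∀ v : Rd d, ‖v + a‖ ^ 2 - gaussEnergy d
      = (‖v‖ ^ 2 + 2 * ⟪a, v⟫) + (‖a‖ ^ 2 - gaussEnergy d) := fun v => by
    rw [norm_add_sq_real, real_inner_comm]; ring
  have i1 : Integrable (fun v : Rd d => ‖v‖ ^ 2) (gauss d) := integrable_norm_pow d 2
  have i2 : Integrable (fun v : Rd d => 2 * ⟪a, v⟫) (gauss d) :=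
    ((IsGaussian.integrable_id (μ := gauss d)).const_inner a).const_mul 2
  have i3 : Integrable (fun v : Rd d => ‖v‖ ^ 2 + 2 * ⟪a, v⟫) (gauss d) := i1.add i2
  simp only [e]
  rw [integral_add i3 (integrable_const _), integral_add i1 i2, integral_const_mul,
    integral_inner_gauss]
  simp [gaussEnergy]

/-- The spectral gap of the linearized Maxwell collision operator. -/
lemma norm_diffOp_sq_ge {d : ℕ} (hd : 0 < d) (f : Lp ℝ 2 (gauss d)) :
    8 / (d * (d + 2)) * (2 * (d - 1) / 3 * (‖f‖ ^ 2 - ⟪f, expoL 0⟫ ^ 2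
      - ∑ i : Fin d, ⟪f, coordL i⟫ ^ 2) - 1 / 2 * ⟪f, energyL d⟫ ^ 2) ≤ ‖diffOp hd f‖ ^ 2 := by
  have hclosed : IsClosed {f : Lp ℝ 2 (gauss d) |
      8 / (d * (d + 2)) * (2 * (d - 1) / 3 * (‖f‖ ^ 2 - ⟪f, expoL 0⟫ ^ 2
      - ∑ i : Fin d, ⟪f, coordL i⟫ ^ 2) - 1 / 2 * ⟪f, energyL d⟫ ^ 2) ≤ ‖diffOp hd f‖ ^ 2} :=
    isClosed_le (by fun_prop) (by fun_prop)
  have hmem : f ∈ closure (Submodule.span ℝ (Set.range (expoL (d := d))) : Set (Lp ℝ 2 (gauss d))) := by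
    rw [← Submodule.topologicalClosure_coe, topologicalClosure_span_expoL]; trivial
  refine hclosed.closure_subset_iff.mpr (fun f hf => ?_) hmem
  obtain ⟨c, rfl⟩ := Finsupp.mem_span_range_iff_exists_finsupp.mp hf
  rw [Set.mem_ofPred_eq, Finsupp.sum, map_sum]
  simp only [map_smul, norm_sq_sum_eq_kerForm, inner_sum_sq_eq_kerForm, inner_expoL_expoL,
    inner_expoL_coordL, inner_expoL_energyL, inner_zero_right, Real.exp_zero]
  have h := kerForm_maxwellKer_ge hd c.support c
  have e1 : kerForm c.support c (fun a b => ⟪diffOp hd (expoL a), diffOp hd (expoL b)⟫)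
      = 4 * kerForm c.support c (maxwellKer d) := by
    rw [← kerForm_const_mul]
    congr 1; ext a b
    exact inner_diffOp_expo hd a b
  have e2 : ∑ i : Fin d, kerForm c.support c (fun a b => a i * b i)
      = kerForm c.support c fun a b => ⟪a, b⟫ := by
    simp only [kerForm]
    rw [Finset.sum_comm]
    refine Finset.sum_congr rfl fun a _ => ?_
    rw [Finset.sum_comm]
    refine Finset.sum_congr rfl fun b _ => ?_
    rw [← Finset.mul_sum]
    congr 1
    simp [PiLp.inner_apply, mul_comm]
  rw [kerForm_sub, kerForm_sub] at h
  rw [e1, e2]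
  simp only [mul_one]
  calc _ = 4 * _ := by ring
    _ ≤ _ := mul_le_mul_of_nonneg_left h (by norm_num)

/-- Coercivity of the Maxwell Dirichlet form on the orthogonal complement of the invariants. -/
lemma integral_diff_sq_ge {d : ℕ} (hd : 0 < d) {g : Rd d → ℝ} (hg : MemLp g 2 (gauss d))
    (h0 : ∫ v, g v ∂(gauss d) = 0) (h1 : ∀ i : Fin d, ∫ v, g v * v i ∂(gauss d) = 0)
    (h2 : ∫ v, g v * ‖v‖ ^ 2 ∂(gauss d) = 0) :
    16 * (d - 1) / (3 * (d * (d + 2))) * ∫ v, g v ^ 2 ∂(gauss d)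
      ≤ ∫ q, diff g q ^ 2 ∂(collMeasure d) := by
  have h := norm_diffOp_sq_ge hd (hg.toLp g)
  have k0 : ⟪hg.toLp g, expoL 0⟫ = 0 := by
    rw [expoL, inner_toLp]; simpa [expo] using h0
  have k1 : ∀ i, ⟪hg.toLp g, coordL i⟫ = 0 := fun i => by
    rw [coordL, inner_toLp]; exact h1 i
  have k2 : ⟪hg.toLp g, energyL d⟫ = 0 := by
    rw [energyL, inner_toLp]
    simp only [mul_sub]
    rw [integral_sub, integral_mul_const, h0, h2]
    · simp
    · exact hg.integrable_mul (memLp_norm_sq d)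
    · exact (hg.integrable (by norm_num)).mul_const _
  rw [diffOp_toLp, norm_sq_toLp, norm_sq_toLp, k0, k2] at h
  simp only [k1] at h
  refine le_trans (le_of_eq ?_) h
  simp
  field_simp
  ring

lemma inner_sub_swap {d : ℕ} (q : Coll d) :
    ⟪q.2.2 - q.2.1, (q.1 : Rd d)⟫ = -⟪q.2.1 - q.2.2, (q.1 : Rd d)⟫ := by
  rw [← inner_neg_left, neg_sub]

/-- The symmetrized hard-sphere cross section `|(v - v*)·ω|`. -/
def crossSec {d : ℕ} (q : Coll d) : ℝ := |⟪q.2.1 - q.2.2, (q.1 : Rd d)⟫|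

lemma crossSec_nonneg {d : ℕ} (q : Coll d) : 0 ≤ crossSec q := abs_nonneg _

lemma crossSec_scatter {d : ℕ} (q : Coll d) : crossSec (scatter q) = crossSec q := by
  simp only [crossSec, scatter, inner_collMap, abs_neg]

lemma crossSec_swapPair {d : ℕ} (q : Coll d) : crossSec (swapPair q) = crossSec q := by
  simp only [crossSec, swapPair, Prod.fst_swap, Prod.snd_swap]
  rw [← neg_sub, inner_neg_left, abs_neg]

lemma continuous_crossSec {d : ℕ} : Continuous (crossSec (d := d)) := by
  unfold crossSec; fun_prop

lemma crossSec_le {d : ℕ} (q : Coll d) : crossSec q ≤ ‖q.2.1‖ + ‖q.2.2‖ := by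
  refine (abs_real_inner_le_norm _ _).trans ?_
  rw [norm_eq_of_mem_sphere q.1, mul_one]
  exact norm_sub_le _ _

lemma crossSec_le_mul {d : ℕ} (q : Coll d) : crossSec q ≤ (1 + ‖q.2.1‖) * (1 + ‖q.2.2‖) := by
  nlinarith [crossSec_le q, norm_nonneg q.2.1, norm_nonneg q.2.2,
    mul_nonneg (norm_nonneg q.2.1) (norm_nonneg q.2.2)]

lemma crossSec_ge {d : ℕ} (q : Coll d) : |⟪q.2.1, (q.1 : Rd d)⟫| - ‖q.2.2‖ ≤ crossSec q := by
  have h : |⟪q.2.2, (q.1 : Rd d)⟫| ≤ ‖q.2.2‖ := by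
    refine (abs_real_inner_le_norm _ _).trans ?_
    rw [norm_eq_of_mem_sphere q.1, mul_one]
  rw [crossSec, inner_sub_left]
  linarith [abs_sub_abs_le_abs_sub ⟪q.2.1, (q.1 : Rd d)⟫ ⟪q.2.2, (q.1 : Rd d)⟫]

lemma measurable_diff {d : ℕ} {g : Rd d → ℝ} (hg : Measurable g) : Measurable (diff g) := by
  have h1 := hg.comp (continuous_scatter (d := d)).measurable.snd.fst
  have h2 := hg.comp (continuous_scatter (d := d)).measurable.snd.snd
  have h3 : Measurable fun q : Coll d => g q.2.1 := by fun_prop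
  have h4 : Measurable fun q : Coll d => g q.2.2 := by fun_prop
  exact ((h1.add h2).sub h3).sub h4

lemma diff_swapPair {d : ℕ} (g : Rd d → ℝ) (q : Coll d) : diff g (swapPair q) = diff g q := by
  have hn := inner_sub_swap q
  have h1 : vOut d q.2.2 q.2.1 q.1 = vsOut d q.2.1 q.2.2 q.1 := by
    rw [vOut, vsOut, hn, neg_smul, sub_neg_eq_add]
  have h2 : vsOut d q.2.2 q.2.1 q.1 = vOut d q.2.1 q.2.2 q.1 := by
    rw [vOut, vsOut, hn, neg_smul, ← sub_eq_add_neg]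
  simp only [diff, collDiff, swapPair, Prod.fst_swap, Prod.snd_swap, h1, h2]
  ring

/-- The sum of a function over the four relabelings of a collision. -/
def fourSum {d : ℕ} (F : Coll d → ℝ) (q : Coll d) : ℝ :=
  F q + F (swapPair q) + F (scatter q) + F (swapPair (scatter q))

lemma integrable_fourSum {d : ℕ} {F : Coll d → ℝ} (hF : Integrable F (collMeasure d)) :
    Integrable (fourSum F) (collMeasure d) := by
  have hS := (measurePreserving_swapPair d).integrable_comp_of_integrable hF
  have hJ := (measurePreserving_scatter d).integrable_comp_of_integrable hF
  have hSJ := (measurePreserving_scatter d).integrable_comp_of_integrable hS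
  exact ((hF.add hS).add hJ).add hSJ

lemma integral_comp_of_measurePreserving {α β : Type*} [MeasurableSpace α] [MeasurableSpace β]
    {μ : Measure α} {ν : Measure β} {f : α → β} (hf : MeasurePreserving f μ ν) {F : β → ℝ}
    (hF : AEStronglyMeasurable F ν) : ∫ x, F (f x) ∂μ = ∫ y, F y ∂ν := by
  rw [← hf.map_eq] at hF ⊢
  exact (integral_map hf.measurable.aemeasurable hF).symm

lemma integral_fourSum {d : ℕ} {F : Coll d → ℝ} (hF : Integrable F (collMeasure d)) :
    ∫ q, fourSum F q ∂(collMeasure d) = 4 * ∫ q, F q ∂(collMeasure d) := by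
  have hS := (measurePreserving_swapPair d).integrable_comp_of_integrable hF
  have hJ := (measurePreserving_scatter d).integrable_comp_of_integrable hF
  have hSJ := (measurePreserving_scatter d).integrable_comp_of_integrable hS
  have e1 := integral_comp_of_measurePreserving (measurePreserving_swapPair d) hF.1
  have e2 := integral_comp_of_measurePreserving (measurePreserving_scatter d) hF.1
  have e3 := integral_comp_of_measurePreserving (measurePreserving_scatter d) hS.1
  simp only [Function.comp_def] at hS hJ hSJ e3
  have h2 : Integrable (fun q => F q + F (swapPair q)) (collMeasure d) := hF.add hS
  have h3 : Integrable (fun q => F q + F (swapPair q) + F (scatter q)) (collMeasure d) := h2.add hJ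
  simp only [fourSum]
  rw [integral_add h3 hSJ, integral_add h2 hJ, integral_add hF hS,
    e1, e2, e3, e1]
  ring

lemma diff_sq_le {d : ℕ} (g : Rd d → ℝ) (q : Coll d) :
    diff g q ^ 2 ≤ 4 * fourSum (fun q => g q.2.1 ^ 2) q := by
  change (g (vOut d q.2.1 q.2.2 q.1) + g (vsOut d q.2.1 q.2.2 q.1) - g q.2.1 - g q.2.2) ^ 2
    ≤ 4 * (g q.2.1 ^ 2 + g q.2.2 ^ 2 + g (vOut d q.2.1 q.2.2 q.1) ^ 2
      + g (vsOut d q.2.1 q.2.2 q.1) ^ 2)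
  generalize g (vOut d q.2.1 q.2.2 q.1) = a
  generalize g (vsOut d q.2.1 q.2.2 q.1) = b
  generalize g q.2.1 = c
  generalize g q.2.2 = e
  nlinarith [sq_nonneg (a - b), sq_nonneg (c - e), sq_nonneg (a + c), sq_nonneg (a + e),
    sq_nonneg (b + c), sq_nonneg (b + e)]

lemma integrable_mul_coll {d : ℕ} {F G : Rd d → ℝ} (hF : Integrable F (gauss d))
    (hG : Integrable G (gauss d)) :
    Integrable (fun q : Coll d => F q.2.1 * G q.2.2) (collMeasure d) :=
  (hF.mul_prod hG).comp_snd (unif d)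

lemma integrable_crossSec_mul_sq {d : ℕ} {g : Rd d → ℝ} (hg : Measurable g)
    (hw : Integrable (fun v => (1 + ‖v‖) * g v ^ 2) (gauss d)) :
    Integrable (fun q : Coll d => crossSec q * g q.2.1 ^ 2) (collMeasure d) := by
  have h := integrable_mul_coll hw (integrable_one_add_norm_pow d 1)
  refine h.mono' ?_ (ae_of_all _ fun q => ?_)
  · have := (continuous_crossSec (d := d)).measurable
    exact Measurable.aestronglyMeasurable (by fun_prop)
  · rw [Real.norm_of_nonneg (mul_nonneg (crossSec_nonneg q) (sq_nonneg _)), pow_one]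
    calc _ ≤ (1 + ‖q.2.1‖) * (1 + ‖q.2.2‖) * g q.2.1 ^ 2 :=
        mul_le_mul_of_nonneg_right (crossSec_le_mul q) (sq_nonneg _)
      _ = _ := by ring

lemma crossSec_mul_diff_sq_le {d : ℕ} (g : Rd d → ℝ) (q : Coll d) :
    crossSec q * diff g q ^ 2 ≤ 4 * fourSum (fun q => crossSec q * g q.2.1 ^ 2) q := by
  have e : fourSum (fun q => crossSec q * g q.2.1 ^ 2) q
      = crossSec q * fourSum (fun q => g q.2.1 ^ 2) q := by
    simp only [fourSum, crossSec_swapPair, crossSec_scatter]; ring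
  rw [e, mul_left_comm]
  exact mul_le_mul_of_nonneg_left (diff_sq_le g q) (crossSec_nonneg q)

lemma integrable_crossSec_mul_diff_sq {d : ℕ} {g : Rd d → ℝ} (hg : Measurable g)
    (hw : Integrable (fun v => (1 + ‖v‖) * g v ^ 2) (gauss d)) :
    Integrable (fun q : Coll d => crossSec q * diff g q ^ 2) (collMeasure d) := by
  refine ((integrable_fourSum (integrable_crossSec_mul_sq hg hw)).const_mul 4).mono' ?_
    (ae_of_all _ fun q => ?_)
  · have := (continuous_crossSec (d := d)).measurable
    have := measurable_diff hg
    exact Measurable.aestronglyMeasurable (by fun_prop)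
  · rw [Real.norm_of_nonneg (mul_nonneg (crossSec_nonneg q) (sq_nonneg _))]
    exact crossSec_mul_diff_sq_le g q

/-- The contribution of grazing collisions is small. -/
lemma integral_grazing_le {d : ℕ} (hd : 0 < d) {g : Rd d → ℝ}
    (h2 : Integrable (fun v => g v ^ 2) (gauss d)) {ε : ℝ} (hε : 0 < ε) :
    Integrable ({q : Coll d | crossSec q < ε}.indicator fun q => g q.2.1 ^ 2) (collMeasure d) ∧
    ∫ q, {q : Coll d | crossSec q < ε}.indicator (fun q => g q.2.1 ^ 2) q ∂(collMeasure d)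
      ≤ 2 * ε * ∫ v, g v ^ 2 ∂(gauss d) := by
  have := isProbabilityMeasure_unif hd
  have hB := (continuous_crossSec (d := d)).measurable
  have hset : MeasurableSet {q : Coll d | crossSec q < ε} := measurableSet_lt hB measurable_const
  have hi0 : Integrable (fun q : Coll d => g q.2.1 ^ 2) (collMeasure d) :=
    (measurePreserving_pre hd).integrable_comp_of_integrable h2
  have hi := hi0.indicator hset
  refine ⟨hi, ?_⟩
  rw [collMeasure] at hi ⊢
  rw [integral_prod _ hi]
  have key : ∀ ω : Sph d, ∫ p, {q : Coll d | crossSec q < ε}.indicator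
      (fun q => g q.2.1 ^ 2) (ω, p) ∂((gauss d).prod (gauss d)) ≤ 2 * ε * ∫ v, g v ^ 2 ∂(gauss d) := by
    intro ω
    have hj : Integrable (fun p : Rd d × Rd d => {q : Coll d | crossSec q < ε}.indicator
        (fun q => g q.2.1 ^ 2) (ω, p)) ((gauss d).prod (gauss d)) := by
      have : Integrable (fun p : Rd d × Rd d => g p.1 ^ 2) ((gauss d).prod (gauss d)) :=
        h2.comp_fst (gauss d)
      exact this.indicator (hset.preimage (by fun_prop : Measurable fun p : Rd d × Rd d => (ω, p)))
    rw [integral_prod _ hj, ← integral_const_mul]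
    refine integral_mono hj.integral_prod_left (h2.const_mul _) fun v => ?_
    have e : (fun vs : Rd d => {q : Coll d | crossSec q < ε}.indicator
        (fun q => g q.2.1 ^ 2) (ω, v, vs))
        = {vs : Rd d | |⟪v, (ω : Rd d)⟫ - ⟪vs, (ω : Rd d)⟫| < ε}.indicator fun _ => g v ^ 2 := by
      ext vs
      simp only [Set.indicator, crossSec, inner_sub_left, Set.mem_ofPred_eq]
    have hm : MeasurableSet {vs : Rd d | |⟪v, (ω : Rd d)⟫ - ⟪vs, (ω : Rd d)⟫| < ε} :=
      measurableSet_lt (by fun_prop) measurable_const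
    simp only [e]
    rw [integral_indicator_const _ hm, smul_eq_mul]
    refine mul_le_mul_of_nonneg_right ?_ (sq_nonneg _)
    have := gauss_slab_le ω ⟪v, (ω : Rd d)⟫ ε
    rwa [max_eq_left hε.le] at this
  calc _ ≤ ∫ ω : Sph d, 2 * ε * ∫ v, g v ^ 2 ∂(gauss d) ∂unif d :=
        integral_mono hi.integral_prod_left (integrable_const _) key
    _ = _ := by simp

/-- Removing the vanishing of the cross section at grazing collisions. -/
lemma integral_crossSec_ge {d : ℕ} (hd : 0 < d) {g : Rd d → ℝ} (hg : Measurable g)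
    (h2 : Integrable (fun v => g v ^ 2) (gauss d))
    (hw : Integrable (fun v => (1 + ‖v‖) * g v ^ 2) (gauss d)) {ε : ℝ} (hε : 0 < ε) :
    ε * ∫ q, diff g q ^ 2 ∂(collMeasure d) - 32 * ε ^ 2 * ∫ v, g v ^ 2 ∂(gauss d)
      ≤ ∫ q, crossSec q * diff g q ^ 2 ∂(collMeasure d) := by
  obtain ⟨hi, hle⟩ := integral_grazing_le hd h2 hε
  have hD : Integrable (fun q => diff g q ^ 2) (collMeasure d) :=
    (memLp_diff hd ((memLp_two_iff_integrable_sq hg.aestronglyMeasurable).mpr h2)).integrable_sq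
  have hpt : ∀ q : Coll d, ε * diff g q ^ 2
      - 4 * ε * fourSum ({q : Coll d | crossSec q < ε}.indicator fun q => g q.2.1 ^ 2) q
      ≤ crossSec q * diff g q ^ 2 := by
    intro q
    by_cases h : crossSec q < ε
    · have e : fourSum ({q : Coll d | crossSec q < ε}.indicator fun q => g q.2.1 ^ 2) q
          = fourSum (fun q => g q.2.1 ^ 2) q := by
        simp only [fourSum, Set.indicator, Set.mem_ofPred_eq, crossSec_swapPair, crossSec_scatter,
          if_pos h]
      rw [e]
      nlinarith [diff_sq_le g q, mul_nonneg (crossSec_nonneg q) (sq_nonneg (diff g q))]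
    · have e : fourSum ({q : Coll d | crossSec q < ε}.indicator fun q => g q.2.1 ^ 2) q = 0 := by
        simp only [fourSum, Set.indicator, Set.mem_ofPred_eq, crossSec_swapPair, crossSec_scatter,
          if_neg h, add_zero]
      rw [e, mul_zero, sub_zero]
      exact mul_le_mul_of_nonneg_right (not_lt.mp h) (sq_nonneg _)
  have hF := (integrable_fourSum hi).const_mul (4 * ε)
  have h := integral_mono ((hD.const_mul ε).sub hF) (integrable_crossSec_mul_diff_sq hg hw) hpt
  rw [integral_sub' (hD.const_mul ε) hF, integral_const_mul, integral_const_mul,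
    integral_fourSum hi] at h
  nlinarith [mul_le_mul_of_nonneg_left hle hε.le]

/-- Weighted Young inequality for the square of a collision difference. -/
lemma sq_collision_ge {x₁ x₂ y₁ y₂ φ₁ φ₂ ψ₁ ψ₂ : ℝ} (h₁ : 0 < φ₁) (h₂ : 0 < φ₂) (k₁ : 0 < ψ₁)
    (k₂ : 0 < ψ₂) :
    x₁ ^ 2 * (1 - (ψ₁ + ψ₂) / φ₁) + x₁ * x₂ + (x₂ ^ 2 * (1 - (ψ₂ + ψ₁) / φ₂) + x₂ * x₁)
      + (y₁ ^ 2 * (1 - (φ₁ + φ₂) / ψ₁) + y₁ * y₂) + (y₂ ^ 2 * (1 - (φ₂ + φ₁) / ψ₂) + y₂ * y₁)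
      ≤ (y₁ + y₂ - x₁ - x₂) ^ 2 := by
  have key : ∀ {x y φ ψ : ℝ}, 0 < φ → 0 < ψ → 2 * x * y ≤ x ^ 2 * (ψ / φ) + y ^ 2 * (φ / ψ) := by
    intro x y φ ψ hφ hψ
    have e : x ^ 2 * (ψ / φ) + y ^ 2 * (φ / ψ) - 2 * x * y = (x * ψ - y * φ) ^ 2 / (φ * ψ) := by
      field_simp
      ring
    have : 0 ≤ (x * ψ - y * φ) ^ 2 / (φ * ψ) := by positivity
    linarith
  have a := key (x := x₁) (y := y₁) h₁ k₁
  have b := key (x := x₁) (y := y₂) h₁ k₂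
  have c := key (x := x₂) (y := y₁) h₂ k₁
  have e := key (x := x₂) (y := y₂) h₂ k₂
  simp only [add_div]
  nlinarith

/-- The quartic weight used to control large velocities. -/
def quartic {d : ℕ} (v : Rd d) : ℝ := 1 + ‖v‖ ^ 4

lemma quartic_pos {d : ℕ} (v : Rd d) : 0 < quartic v := by unfold quartic; positivity

/-- The part of `crossSec * diff g ^ 2` charged to one of the four velocities. -/
def share {d : ℕ} (g : Rd d → ℝ) (q : Coll d) : ℝ :=
  crossSec q * (g q.2.1 ^ 2
    * (1 - (quartic (scatter q).2.1 + quartic (scatter q).2.2) / quartic q.2.1)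
    + g q.2.1 * g q.2.2)

lemma scatter_swapPair {d : ℕ} (q : Coll d) : scatter (swapPair q) = swapPair (scatter q) := by
  have hn := inner_sub_swap q
  simp only [scatter, swapPair, collMap_apply, Prod.fst_swap, Prod.snd_swap, vOut, vsOut, hn,
    neg_smul, sub_neg_eq_add, ← sub_eq_add_neg, Prod.swap_prod_mk]

lemma fourSum_share_le {d : ℕ} (g : Rd d → ℝ) (q : Coll d) :
    fourSum (share g) q ≤ crossSec q * diff g q ^ 2 := by
  have h := sq_collision_ge (x₁ := g q.2.1) (x₂ := g q.2.2) (y₁ := g (scatter q).2.1)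
    (y₂ := g (scatter q).2.2) (quartic_pos q.2.1) (quartic_pos q.2.2)
    (quartic_pos (scatter q).2.1) (quartic_pos (scatter q).2.2)
  have h' := mul_le_mul_of_nonneg_left h (crossSec_nonneg q)
  refine le_trans (le_of_eq ?_) h'
  have e1 : scatter (swapPair (scatter q)) = swapPair q := by
    rw [scatter_swapPair, scatter_scatter]
  simp only [fourSum, share, crossSec_swapPair, crossSec_scatter, e1, scatter_swapPair,
    scatter_scatter]
  simp only [swapPair, Prod.fst_swap, Prod.snd_swap]
  ring

/-- Scalar form of the gain at large velocities. -/
lemma gain_ge {n m t B p ε : ℝ} (hn : 0 ≤ n) (hm : 0 ≤ m) (ht : 0 ≤ t) (htn : t ≤ n) (hB : 0 ≤ B)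
    (hB1 : t - m ≤ B) (hB2 : B ≤ n + m) (hp : (n ^ 2 - t ^ 2) * t ^ 2 ≤ p) (hε : 0 ≤ ε) :
    2 * ε * (n ^ 3 * t ^ 2 - n * (t ^ 2) ^ 2 - ε ^ 2 * n ^ 5) - 2 * (1 + n ^ 4) * (1 + m) ^ 5
      ≤ B * (1 + n ^ 4 - (2 + (n ^ 2 + m ^ 2) ^ 2 - 2 * p)) := by
  have h0 : 0 ≤ n ^ 2 - t ^ 2 := by nlinarith
  have h1 : 0 ≤ (n ^ 2 - t ^ 2) * t ^ 2 := by positivity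
  have h2 : (n ^ 2 - t ^ 2) * t ^ 2 * (t - m) ≤ p * B :=
    (mul_le_mul_of_nonneg_left hB1 h1).trans (mul_le_mul_of_nonneg_right hp hB)
  have h3 : (n ^ 2 - t ^ 2) * t ^ 2 ≤ n ^ 4 / 4 := by nlinarith [sq_nonneg (n ^ 2 - 2 * t ^ 2)]
  have h3' := mul_le_mul_of_nonneg_right h3 hm
  have h4 : B * (1 + 2 * n ^ 2 * m ^ 2 + m ^ 4) ≤ (n + m) * (1 + 2 * n ^ 2 * m ^ 2 + m ^ 4) :=
    mul_le_mul_of_nonneg_right hB2 (by positivity)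
  have h5 : ε * n * ((n ^ 2 - t ^ 2) * t ^ 2) - ε ^ 3 * n ^ 5 ≤ (n ^ 2 - t ^ 2) * t ^ 2 * t := by
    rcases le_or_gt (ε * n) t with h | h
    · have := mul_le_mul_of_nonneg_left h h1
      have : 0 ≤ ε ^ 3 * n ^ 5 := by positivity
      nlinarith
    · have a1 : t ^ 2 ≤ (ε * n) ^ 2 := by gcongr
      have a2 : (n ^ 2 - t ^ 2) * t ^ 2 ≤ n ^ 2 * (ε * n) ^ 2 := by
        apply mul_le_mul _ a1 (by positivity) (by positivity)
        nlinarith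
      have a3 := mul_le_mul a2 (show ε * n - t ≤ ε * n by linarith) (by linarith) (by positivity)
      nlinarith
  have h6 : m * n ^ 4 / 2 + (n + m) * (1 + 2 * n ^ 2 * m ^ 2 + m ^ 4)
      ≤ 2 * (1 + n ^ 4) * (1 + m) ^ 5 := by
    have b2 : n ^ 2 ≤ (1 + n ^ 4) / 2 := by nlinarith [sq_nonneg (n ^ 2 - 1)]
    have b1 : n ≤ 1 + n ^ 4 := by nlinarith [sq_nonneg (n - 1)]
    have b3 : n ^ 3 ≤ 1 + n ^ 4 := by nlinarith [sq_nonneg (n ^ 2 - n)]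
    have c1 := mul_le_mul_of_nonneg_right b1 (show 0 ≤ 1 + m ^ 4 by positivity)
    have c2 := mul_le_mul_of_nonneg_right b2 (show 0 ≤ 2 * m ^ 3 by positivity)
    have c3 := mul_le_mul_of_nonneg_right b3 (show 0 ≤ 2 * m ^ 2 by positivity)
    have hs : 0 ≤ n ^ 4 := by positivity
    have : 0 ≤ (1 + n ^ 4) * (1 + m + m ^ 2 + m ^ 3 + m ^ 4 + m ^ 5) := by positivity
    have d1 : (1 + m ^ 4) + m ^ 3 + 2 * m ^ 2 + 2 * m + m ^ 5 ≤ 2 * (1 + m) ^ 5 := by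
      have : 2 * (1 + m) ^ 5 - ((1 + m ^ 4) + m ^ 3 + 2 * m ^ 2 + 2 * m + m ^ 5)
        = 1 + 8 * m + 18 * m ^ 2 + 19 * m ^ 3 + 9 * m ^ 4 + m ^ 5 := by ring
      have : 0 ≤ 1 + 8 * m + 18 * m ^ 2 + 19 * m ^ 3 + 9 * m ^ 4 + m ^ 5 := by positivity
      linarith
    have d2 := mul_le_mul_of_nonneg_left d1 (show 0 ≤ 1 + n ^ 4 by positivity)
    have f1 : 0 ≤ n ^ 4 * m := by positivity
    have f2 : 0 ≤ n ^ 4 * m ^ 5 := by positivity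
    have f3 : 0 ≤ m := hm
    nlinarith
  nlinarith

lemma quartic_add_quartic_scatter {d : ℕ} (q : Coll d) :
    quartic (scatter q).2.1 + quartic (scatter q).2.2 = 2 + (‖q.2.1‖ ^ 2 + ‖q.2.2‖ ^ 2) ^ 2
      - 2 * (‖(scatter q).2.1‖ ^ 2 * ‖(scatter q).2.2‖ ^ 2) := by
  have h := norm_sq_collMap q.1 q.2
  rw [← h]
  simp only [quartic, scatter]
  ring

lemma abs_inner_sphere_le {d : ℕ} (v : Rd d) (ω : Sph d) : |⟪v, (ω : Rd d)⟫| ≤ ‖v‖ := by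
  refine (abs_real_inner_le_norm _ _).trans ?_
  rw [norm_eq_of_mem_sphere ω, mul_one]

lemma norm_scatter_mul_ge {d : ℕ} (q : Coll d) :
    (‖q.2.1‖ ^ 2 - |⟪q.2.1, (q.1 : Rd d)⟫| ^ 2) * |⟪q.2.1, (q.1 : Rd d)⟫| ^ 2
      ≤ ‖(scatter q).2.1‖ ^ 2 * ‖(scatter q).2.2‖ ^ 2 := by
  have hω : ‖(q.1 : Rd d)‖ = 1 := norm_eq_of_mem_sphere q.1
  have hωω : ⟪(q.1 : Rd d), (q.1 : Rd d)⟫ = 1 := by rw [real_inner_self_eq_norm_sq, hω, one_pow]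
  have h1 : ‖q.2.1‖ ^ 2 - |⟪q.2.1, (q.1 : Rd d)⟫| ^ 2 ≤ ‖(scatter q).2.1‖ ^ 2 := by
    simp only [scatter, collMap_apply, vOut, norm_sub_sq_real, inner_smul_right, norm_smul, hω,
      Real.norm_eq_abs, mul_one, sq_abs]
    nlinarith [sq_nonneg (⟪q.2.1, (q.1 : Rd d)⟫ - ⟪q.2.1 - q.2.2, (q.1 : Rd d)⟫)]
  have h2 : |⟪q.2.1, (q.1 : Rd d)⟫| ^ 2 ≤ ‖(scatter q).2.2‖ ^ 2 := by
    have e : ⟪q.2.1, (q.1 : Rd d)⟫ = ⟪(scatter q).2.2, (q.1 : Rd d)⟫ := by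
      simp only [scatter, collMap_apply, vsOut, inner_add_left, inner_smul_left, hωω,
        inner_sub_left]
      simp
    rw [e]
    gcongr
    exact abs_inner_sphere_le _ _
  exact mul_le_mul h1 h2 (by positivity) (by positivity)

/-- The main part of the lower bound for `share`. -/
def gain {d : ℕ} (ε : ℝ) (g : Rd d → ℝ) (ω : Sph d) (v : Rd d) : ℝ :=
  g v ^ 2 / quartic v * (2 * ε * (‖v‖ ^ 3 * ⟪v, (ω : Rd d)⟫ ^ 2
    - ‖v‖ * (⟪v, (ω : Rd d)⟫ ^ 2 * ⟪v, (ω : Rd d)⟫ ^ 2) - ε ^ 2 * ‖v‖ ^ 5))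

/-- The error part of the lower bound for `share`. -/
def loss {d : ℕ} (g : Rd d → ℝ) (v vs : Rd d) : ℝ :=
  2 * (g v ^ 2 * (1 + ‖vs‖) ^ 5)
    + (g v ^ 2 * (1 + ‖vs‖) ^ 2 + (1 + ‖v‖) ^ 2 * g vs ^ 2) / 2

lemma share_ge {d : ℕ} (g : Rd d → ℝ) {ε : ℝ} (hε : 0 ≤ ε) (q : Coll d) :
    gain ε g q.1 q.2.1 - loss g q.2.1 q.2.2 ≤ share g q := by
  have hφ := quartic_pos q.2.1
  have h := gain_ge (norm_nonneg q.2.1) (norm_nonneg q.2.2) (abs_nonneg _)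
    (abs_inner_sphere_le q.2.1 q.1) (crossSec_nonneg q) (crossSec_ge q) (crossSec_le q)
    (norm_scatter_mul_ge q) hε
  rw [← quartic_add_quartic_scatter, sq_abs] at h
  have h1 := mul_le_mul_of_nonneg_left h (show 0 ≤ g q.2.1 ^ 2 / quartic q.2.1 by positivity)
  have e1 : g q.2.1 ^ 2 / quartic q.2.1 * (crossSec q * (1 + ‖q.2.1‖ ^ 4
      - (quartic (scatter q).2.1 + quartic (scatter q).2.2)))
      = crossSec q * (g q.2.1 ^ 2
        * (1 - (quartic (scatter q).2.1 + quartic (scatter q).2.2) / quartic q.2.1)) := by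
    change g q.2.1 ^ 2 / quartic q.2.1 * (crossSec q * (quartic q.2.1
      - (quartic (scatter q).2.1 + quartic (scatter q).2.2))) = _
    field_simp
  have e2 : g q.2.1 ^ 2 / quartic q.2.1 * (2 * (1 + ‖q.2.1‖ ^ 4) * (1 + ‖q.2.2‖) ^ 5)
      = 2 * (g q.2.1 ^ 2 * (1 + ‖q.2.2‖) ^ 5) := by
    change g q.2.1 ^ 2 / quartic q.2.1 * (2 * quartic q.2.1 * (1 + ‖q.2.2‖) ^ 5) = _
    field_simp
  rw [e1, mul_sub, e2] at h1
  have h2 : -((g q.2.1 ^ 2 * (1 + ‖q.2.2‖) ^ 2 + (1 + ‖q.2.1‖) ^ 2 * g q.2.2 ^ 2) / 2)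
      ≤ crossSec q * (g q.2.1 * g q.2.2) := by
    have a := mul_le_mul_of_nonneg_right (crossSec_le_mul q) (abs_nonneg (g q.2.1 * g q.2.2))
    have b := mul_le_mul_of_nonneg_left (neg_abs_le (g q.2.1 * g q.2.2)) (crossSec_nonneg q)
    rw [abs_mul] at a b
    have c := two_mul_le_add_sq (|g q.2.1| * (1 + ‖q.2.2‖)) (|g q.2.2| * (1 + ‖q.2.1‖))
    rw [mul_pow, mul_pow, sq_abs, sq_abs] at c
    nlinarith
  unfold gain loss share
  rw [← sq ((⟪q.2.1, (q.1 : Rd d)⟫) ^ 2)]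
  linarith

lemma integrable_loss {d : ℕ} {g : Rd d → ℝ} (h2 : Integrable (fun v => g v ^ 2) (gauss d)) :
    Integrable (fun q : Coll d => loss g q.2.1 q.2.2) (collMeasure d) :=
  ((integrable_mul_coll h2 (integrable_one_add_norm_pow d 5)).const_mul 2).add
    (((integrable_mul_coll h2 (integrable_one_add_norm_pow d 2)).add
      (integrable_mul_coll (integrable_one_add_norm_pow d 2) h2)).div_const 2)

lemma integral_mul_coll {d : ℕ} (hd : 0 < d) (F G : Rd d → ℝ) :
    ∫ q, F q.2.1 * G q.2.2 ∂(collMeasure d) = (∫ v, F v ∂(gauss d)) * ∫ v, G v ∂(gauss d) := by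
  have := isProbabilityMeasure_unif hd
  rw [collMeasure, ← integral_prod_mul]
  have := integral_prod_mul (μ := unif d) (ν := (gauss d).prod (gauss d)) (fun _ => (1 : ℝ))
    (fun p => F p.1 * G p.2)
  simpa using this

lemma integral_loss {d : ℕ} (hd : 0 < d) {g : Rd d → ℝ}
    (h2 : Integrable (fun v => g v ^ 2) (gauss d)) :
    ∫ q, loss g q.2.1 q.2.2 ∂(collMeasure d)
      = (2 * (∫ v, (1 + ‖v‖) ^ 5 ∂(gauss d)) + ∫ v, (1 + ‖v‖) ^ 2 ∂(gauss d))
        * ∫ v, g v ^ 2 ∂(gauss d) := by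
  have i1 := integrable_mul_coll h2 (integrable_one_add_norm_pow d 5)
  have i2 := integrable_mul_coll h2 (integrable_one_add_norm_pow d 2)
  have i3 := integrable_mul_coll (integrable_one_add_norm_pow d 2) h2
  have i4 : Integrable (fun q : Coll d => (g q.2.1 ^ 2 * (1 + ‖q.2.2‖) ^ 2
    + (1 + ‖q.2.1‖) ^ 2 * g q.2.2 ^ 2) / 2) (collMeasure d) := (i2.add i3).div_const 2
  unfold loss
  rw [integral_add (i1.const_mul 2) i4, integral_const_mul,
    integral_div, integral_add i2 i3]
  rw [integral_mul_coll hd (fun v => g v ^ 2) fun v => (1 + ‖v‖) ^ 5,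
    integral_mul_coll hd (fun v => g v ^ 2) fun v => (1 + ‖v‖) ^ 2,
    integral_mul_coll hd (fun v => (1 + ‖v‖) ^ 2) fun v => g v ^ 2]
  ring

lemma abs_gain_le {d : ℕ} {ε : ℝ} (hε : 0 ≤ ε) (g : Rd d → ℝ) (ω : Sph d) (v : Rd d) :
    |gain ε g ω v| ≤ 2 * ε * (1 + ε ^ 2) * ((1 + ‖v‖) * g v ^ 2) := by
  have hφ := quartic_pos v
  have hT : 0 ≤ ⟪v, (ω : Rd d)⟫ ^ 2 := sq_nonneg _
  have ht : ⟪v, (ω : Rd d)⟫ ^ 2 ≤ ‖v‖ ^ 2 := sq_le_sq.mpr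
    ((abs_inner_sphere_le v ω).trans (le_abs_self _))
  have hn := norm_nonneg v
  unfold gain
  rw [abs_mul, abs_of_nonneg (show 0 ≤ g v ^ 2 / quartic v by positivity), abs_mul,
    abs_of_nonneg (show 0 ≤ 2 * ε by positivity)]
  generalize ⟪v, (ω : Rd d)⟫ ^ 2 = T at *
  have h1 : 0 ≤ ‖v‖ * (T * (‖v‖ ^ 2 - T)) := mul_nonneg hn (mul_nonneg hT (by linarith))
  have h2 : ‖v‖ * (T * (‖v‖ ^ 2 - T)) ≤ ‖v‖ * (‖v‖ ^ 2 * ‖v‖ ^ 2) :=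
    mul_le_mul_of_nonneg_left (mul_le_mul ht (by linarith) (by linarith) (by positivity)) hn
  have h3 : 0 ≤ ε ^ 2 * ‖v‖ ^ 5 := by positivity
  have h4 : |‖v‖ ^ 3 * T - ‖v‖ * (T * T) - ε ^ 2 * ‖v‖ ^ 5| ≤ (1 + ε ^ 2) * ‖v‖ ^ 5 := by
    rw [abs_le]
    constructor <;> nlinarith
  have h5 : ‖v‖ ^ 5 ≤ (1 + ‖v‖) * quartic v := by
    rw [quartic]
    nlinarith [pow_nonneg hn 4]
  have h6 : |‖v‖ ^ 3 * T - ‖v‖ * (T * T) - ε ^ 2 * ‖v‖ ^ 5|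
      ≤ (1 + ε ^ 2) * ((1 + ‖v‖) * quartic v) := h4.trans (by gcongr)
  calc _ ≤ g v ^ 2 / quartic v * (2 * ε * ((1 + ε ^ 2) * ((1 + ‖v‖) * quartic v))) := by gcongr
    _ = _ := by field_simp

lemma integrable_gain {d : ℕ} (hd : 0 < d) {ε : ℝ} (hε : 0 ≤ ε) {g : Rd d → ℝ} (hg : Measurable g)
    (hw : Integrable (fun v => (1 + ‖v‖) * g v ^ 2) (gauss d)) :
    Integrable (fun q : Coll d => gain ε g q.1 q.2.1) (collMeasure d) := by
  have h := ((measurePreserving_pre hd).integrable_comp_of_integrable hw).const_mul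
    (2 * ε * (1 + ε ^ 2))
  refine h.mono' ?_ (ae_of_all _ fun q => abs_gain_le hε g q.1 q.2.1)
  unfold gain quartic
  exact Measurable.aestronglyMeasurable (by fun_prop)

lemma integral_gain {d : ℕ} (hd : 0 < d) {ε : ℝ} (hε : 0 ≤ ε) {g : Rd d → ℝ} (hg : Measurable g)
    (hw : Integrable (fun v => (1 + ‖v‖) * g v ^ 2) (gauss d)) :
    ∫ q, gain ε g q.1 q.2.1 ∂(collMeasure d)
      = 2 * ε * ((d - 1) / (d * (d + 2)) - ε ^ 2)
        * ∫ v, g v ^ 2 * (‖v‖ ^ 5 / quartic v) ∂(gauss d) := by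
  have := isProbabilityMeasure_unif hd
  have hd' : (d : ℝ) ≠ 0 := by positivity
  have key : ∀ v : Rd d, ∫ ω : Sph d, gain ε g ω v ∂(unif d)
      = 2 * ε * ((d - 1) / (d * (d + 2)) - ε ^ 2) * (g v ^ 2 * (‖v‖ ^ 5 / quartic v)) := by
    intro v
    have c1 : Continuous fun ω : Sph d => ⟪v, (ω : Rd d)⟫ ^ 2 := by fun_prop
    have i1 := (integrable_unif c1).const_mul (‖v‖ ^ 3)
    have i2 : Integrable (fun ω : Sph d => ‖v‖ * (⟪v, (ω : Rd d)⟫ ^ 2 * ⟪v, (ω : Rd d)⟫ ^ 2))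
      (unif d) := (integrable_unif (c1.mul c1)).const_mul ‖v‖
    have i3 : Integrable (fun ω : Sph d => ‖v‖ ^ 3 * ⟪v, (ω : Rd d)⟫ ^ 2
      - ‖v‖ * (⟪v, (ω : Rd d)⟫ ^ 2 * ⟪v, (ω : Rd d)⟫ ^ 2)) (unif d) := i1.sub i2
    unfold gain
    rw [integral_const_mul, integral_const_mul, integral_sub i3 (integrable_const _),
      integral_sub i1 i2, integral_const_mul, integral_const_mul, integral_inner_sq hd,
      integral_inner_sq_mul_inner_sq hd, real_inner_self_eq_norm_sq]
    have hφ := (quartic_pos v).ne'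
    simp only [integral_const, probReal_univ, one_smul]
    field_simp
    ring
  have hi := integrable_gain hd hε hg hw
  rw [collMeasure] at hi ⊢
  rw [integral_prod_symm _ hi]
  simp only [key]
  rw [integral_const_mul, integral_fun_fst (μ := gauss d) (ν := gauss d)
    fun v => g v ^ 2 * (‖v‖ ^ 5 / quartic v)]
  simp

/-- The cross section controls one more power of the velocity, up to an `L²` error. -/
lemma exists_integral_crossSec_ge {d : ℕ} (hd : 1 < d) : ∃ k > (0 : ℝ), ∃ K ≥ (0 : ℝ),
    ∀ g : Rd d → ℝ, Measurable g → Integrable (fun v => g v ^ 2) (gauss d) →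
      Integrable (fun v => (1 + ‖v‖) * g v ^ 2) (gauss d) →
      k * ∫ v, (1 + ‖v‖) * g v ^ 2 ∂(gauss d) - K * ∫ v, g v ^ 2 ∂(gauss d)
        ≤ ∫ q, crossSec q * diff g q ^ 2 ∂(collMeasure d) := by
  have hd0 : 0 < d := by lia
  have hd1 : (1 : ℝ) < d := by exact_mod_cast hd
  set A : ℝ := (d - 1) / (d * (d + 2)) with hA
  have hA0 : 0 < A := div_pos (by linarith) (by positivity)
  have hA1 : A ≤ 1 := by rw [hA, div_le_one (by positivity)]; nlinarith
  set κ : ℝ := 2 * (A / 2) * (A - (A / 2) ^ 2) with hκ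
  have hκ0 : 0 < κ := mul_pos (by positivity) (by nlinarith)
  refine ⟨4 * κ, by positivity, 8 * κ + 4 * (2 * (∫ v, (1 + ‖v‖) ^ 5 ∂(gauss d))
    + ∫ v, (1 + ‖v‖) ^ 2 ∂(gauss d)), ?_, fun g hg h2 hw => ?_⟩
  · have : 0 ≤ ∫ v, (1 + ‖v‖) ^ 5 ∂(gauss d) := integral_nonneg fun v => by positivity
    have : 0 ≤ ∫ v, (1 + ‖v‖) ^ 2 ∂(gauss d) := integral_nonneg fun v => by positivity
    positivity
  have hG := integrable_gain hd0 (half_pos hA0).le hg hw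
  have hL := integrable_loss h2
  have hQ : Integrable (fun q : Coll d => gain (A / 2) g q.1 q.2.1 - loss g q.2.1 q.2.2)
    (collMeasure d) := hG.sub hL
  have hle := integral_mono (integrable_fourSum hQ) (integrable_crossSec_mul_diff_sq hg hw)
    fun q => le_trans (by
      have := share_ge g (half_pos hA0).le
      exact add_le_add (add_le_add (add_le_add (this _) (this _)) (this _)) (this _))
      (fourSum_share_le g q)
  rw [integral_fourSum hQ, integral_sub hG hL, integral_gain hd0 (half_pos hA0).le hg hw,
    integral_loss hd0 h2, ← hA, ← hκ] at hle
  have hb : (∫ v, (1 + ‖v‖) * g v ^ 2 ∂(gauss d)) - 2 * ∫ v, g v ^ 2 ∂(gauss d)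
      ≤ ∫ v, g v ^ 2 * (‖v‖ ^ 5 / quartic v) ∂(gauss d) := by
    rw [← integral_const_mul, ← integral_sub hw (h2.const_mul 2)]
    refine integral_mono (hw.sub (h2.const_mul 2)) ?_ fun v => ?_
    · refine hw.mono' ?_ (ae_of_all _ fun v => ?_)
      · unfold quartic
        exact Measurable.aestronglyMeasurable (by fun_prop)
      · have := quartic_pos v
        rw [Real.norm_of_nonneg (by positivity), mul_comm]
        refine mul_le_mul_of_nonneg_right ?_ (sq_nonneg _)
        rw [div_le_iff₀ this, quartic]
        nlinarith [norm_nonneg v, pow_nonneg (norm_nonneg v) 4]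
    · have : ‖v‖ - 1 ≤ ‖v‖ ^ 5 / quartic v := by
        rw [le_div_iff₀ (quartic_pos v), quartic]
        nlinarith [norm_nonneg v, sq_nonneg (‖v‖ ^ 2 - 1), sq_nonneg (‖v‖ - 1)]
      nlinarith [mul_le_mul_of_nonneg_left this (sq_nonneg (g v))]
  have := mul_le_mul_of_nonneg_left hb hκ0.le
  linarith

/-- The spectral gap for the symmetrized normalized form. -/
lemma exists_coercive_crossSec {d : ℕ} (hd : 1 < d) : ∃ c > (0 : ℝ),
    ∀ g : Rd d → ℝ, Measurable g → Integrable (fun v => (1 + ‖v‖) * g v ^ 2) (gauss d) →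
      (∫ v, g v ∂(gauss d) = 0) → (∀ i : Fin d, ∫ v, g v * v i ∂(gauss d) = 0) →
      (∫ v, g v * ‖v‖ ^ 2 ∂(gauss d) = 0) →
      c * ∫ v, (1 + ‖v‖) * g v ^ 2 ∂(gauss d)
        ≤ ∫ q, crossSec q * diff g q ^ 2 ∂(collMeasure d) := by
  have hd0 : 0 < d := by lia
  have hd1 : (1 : ℝ) < d := by exact_mod_cast hd
  obtain ⟨k, hk, K, hK, hweight⟩ := exists_integral_crossSec_ge hd
  set a : ℝ := 16 * (d - 1) / (3 * (d * (d + 2))) with ha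
  have ha0 : 0 < a := div_pos (by linarith) (by positivity)
  set b : ℝ := a ^ 2 / 128 with hb
  have hb0 : 0 < b := by positivity
  refine ⟨k * b / (b + K), by positivity, fun g hg hw h0 h1 h2 => ?_⟩
  have hs : Integrable (fun v => g v ^ 2) (gauss d) := by
    refine hw.mono' (by fun_prop) (ae_of_all _ fun v => ?_)
    rw [Real.norm_of_nonneg (sq_nonneg _)]
    exact le_mul_of_one_le_left (sq_nonneg _) (by linarith [norm_nonneg v])
  have hgap := integral_diff_sq_ge hd0
    ((memLp_two_iff_integrable_sq hg.aestronglyMeasurable).mpr hs) h0 h1 h2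
  have hε := integral_crossSec_ge hd0 hg hs hw (ε := a / 64) (by positivity)
  have hw' := hweight g hg hs hw
  rw [← ha] at hgap
  set X := ∫ q, crossSec q * diff g q ^ 2 ∂(collMeasure d)
  set I := ∫ v, g v ^ 2 ∂(gauss d)
  set J := ∫ v, (1 + ‖v‖) * g v ^ 2 ∂(gauss d)
  have hX : b * I ≤ X := by
    have := mul_le_mul_of_nonneg_left hgap (show 0 ≤ a / 64 by positivity)
    rw [hb]
    nlinarith
  rw [div_mul_eq_mul_div, div_le_iff₀ (by positivity)]
  nlinarith [mul_le_mul_of_nonneg_left hX hK, mul_le_mul_of_nonneg_left hw' hb0.le]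

lemma gauss_prod_prod_sphMeasure {d : ℕ} (hd : 0 < d) (F : (Rd d × Rd d) × Sph d → ℝ) :
    ∫ p, Maxw d p.1.1 * Maxw d p.1.2 * F p
      ∂(((volume : Measure (Rd d)).prod (volume : Measure (Rd d))).prod (sphMeasure d))
      = (sphMeasure d Set.univ).toReal * ∫ q : Coll d, F q.swap ∂(collMeasure d) := by
  have hm : Measurable fun p : Rd d × Rd d => ENNReal.ofReal (Maxw d p.1 * Maxw d p.2) := by
    have := (continuous_maxw d).measurable
    fun_prop
  have e1 : ∫ p, Maxw d p.1.1 * Maxw d p.1.2 * F p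
      ∂(((volume : Measure (Rd d)).prod (volume : Measure (Rd d))).prod (sphMeasure d))
      = ∫ p, F p ∂(((gauss d).prod (gauss d)).prod (sphMeasure d)) := by
    have hm' : Measurable fun p : (Rd d × Rd d) × Sph d =>
        ENNReal.ofReal (Maxw d p.1.1 * Maxw d p.1.2) := hm.comp measurable_fst
    rw [gauss_prod, prod_withDensity_left hm, integral_withDensity_eq_integral_toReal_smul
      hm' (ae_of_all _ fun _ => ENNReal.ofReal_lt_top)]
    simp only [ENNReal.toReal_ofReal (mul_nonneg (maxw_pos d _).le (maxw_pos d _).le), smul_eq_mul]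
  have := isProbabilityMeasure_unif hd
  rw [e1, ← integral_prod_swap]
  conv_lhs => rw [sphMeasure_eq_smul_unif hd]
  rw [Measure.prod_smul_left, integral_smul_measure, smul_eq_mul, collMeasure]

lemma integral_max_mul_diff_sq {d : ℕ} {g : Rd d → ℝ} (hg : Measurable g)
    (hw : Integrable (fun v => (1 + ‖v‖) * g v ^ 2) (gauss d)) :
    ∫ q : Coll d, max ⟪q.2.1 - q.2.2, (q.1 : Rd d)⟫ 0 * diff g q ^ 2 ∂(collMeasure d)
      = (∫ q, crossSec q * diff g q ^ 2 ∂(collMeasure d)) / 2 := by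
  set F : Coll d → ℝ := fun q => max ⟪q.2.1 - q.2.2, (q.1 : Rd d)⟫ 0 * diff g q ^ 2 with hF
  have hFm : AEStronglyMeasurable F (collMeasure d) := by
    have := measurable_diff hg
    exact Measurable.aestronglyMeasurable (by fun_prop)
  have hFi : Integrable F (collMeasure d) := by
    refine (integrable_crossSec_mul_diff_sq hg hw).mono' hFm (ae_of_all _ fun q => ?_)
    rw [hF, Real.norm_of_nonneg (by positivity)]
    exact mul_le_mul_of_nonneg_right (max_le (le_abs_self _) (abs_nonneg _)) (sq_nonneg _)
  have hS : Integrable (fun q => F (swapPair q)) (collMeasure d) :=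
    (measurePreserving_swapPair d).integrable_comp_of_integrable hFi
  have e : ∀ q, crossSec q * diff g q ^ 2 = F q + F (swapPair q) := by
    intro q
    have hn := inner_sub_swap q
    simp only [hF, diff_swapPair]
    simp only [swapPair, Prod.fst_swap, Prod.snd_swap, hn, crossSec]
    rw [← add_mul, ← max_zero_add_max_neg_zero_eq_abs_self]
  simp only [e]
  rw [integral_add hFi hS,
    integral_comp_of_measurePreserving (measurePreserving_swapPair d) hFm]
  ring

lemma dirichletForm_eq {d : ℕ} (hd : 0 < d) {g : Rd d → ℝ} (hg : Measurable g)
    (hw : Integrable (fun v => (1 + ‖v‖) * g v ^ 2) (gauss d)) :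
    dirichletForm d g = (sphMeasure d Set.univ).toReal / 8
      * ∫ q, crossSec q * diff g q ^ 2 ∂(collMeasure d) := by
  have h := gauss_prod_prod_sphMeasure hd fun p : (Rd d × Rd d) × Sph d =>
    max ⟪p.1.1 - p.1.2, (p.2 : Rd d)⟫ 0 * collDiff d g p.1.1 p.1.2 p.2 ^ 2
  have h' := integral_max_mul_diff_sq hg hw
  simp only [Prod.fst_swap, Prod.snd_swap, ← mul_assoc] at h
  rw [dirichletForm, h]
  simp only [diff] at h' ⊢
  rw [h']
  ring

end HardSphere

/-- coercivity / spectral gap of `ℒ`: for `d ≥ 3` there is `C > 0` such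
that for every `g ∈ L²((1+|v|) M dv)` orthogonal to the collision invariants
`1, v_1, …, v_d, |v|²`, one has `D(g) ≥ C ∫ (1+|v|) g² M dv`. -/
theorem dirichletForm_coercive (d : ℕ) (hd : 3 ≤ d) :
    ∃ C > (0 : ℝ), ∀ g : Rd d → ℝ, Measurable g →
      Integrable (fun v => (1 + ‖v‖) * g v ^ 2 * Maxw d v) →
      (∫ v, g v * Maxw d v) = 0 →
      (∀ i : Fin d, (∫ v : Rd d, g v * v i * Maxw d v) = 0) →
      (∫ v, g v * ‖v‖ ^ 2 * Maxw d v) = 0 →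
      C * ∫ v, (1 + ‖v‖) * g v ^ 2 * Maxw d v ≤ dirichletForm d g := by
  have hd0 : 0 < d := by lia
  have hG : ∀ F : Rd d → ℝ, ∫ v, F v * Maxw d v = ∫ v, F v ∂(HardSphere.gauss d) := fun F => by
    rw [HardSphere.integral_gauss]
    simp only [smul_eq_mul, mul_comm]
  obtain ⟨c, hc, h⟩ := HardSphere.exists_coercive_crossSec (d := d) (by lia)
  have hσ : 0 < (sphMeasure d Set.univ).toReal :=
    ENNReal.toReal_pos (HardSphere.sphMeasure_univ_ne_zero hd0) (measure_ne_top _ _)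
  refine ⟨(sphMeasure d Set.univ).toReal / 8 * c, by positivity, fun g hg hw h0 h1 h2 => ?_⟩
  rw [← HardSphere.integrable_gauss_iff] at hw
  simp only [hG] at h1
  rw [hG] at h0 h2 ⊢
  rw [HardSphere.dirichletForm_eq hd0 hg hw, mul_assoc]
  exact mul_le_mul_of_nonneg_left (h g hg hw h0 h1 h2) (by positivity)

end
end

section
/- Let d ≥ 2. If g ∈ L²(ℝ^d, (1+|v|) M(v) dv) satisfies Δg(v,v*,ω) = 0 for almost every (v,v*,ω) ∈ ℝ^d×ℝ^d×𝕊^{d−1} (equivalently, its Dirichlet form D(g) := (1/4) ∫∫∫ M(v) M(v*) ((v−v*)·ω)_+ (Δg)² dv dv* dω vanishes), then there exist a ∈ ℝ, b ∈ ℝ^d and c ∈ ℝ such that g(v) = a + b·v + c|v|² for almost every v ∈ ℝ^d; that is, the nullspace of the hard-sphere linearized Boltzmann collision operator ℒ is exactly span{1, v_1, …, v_d, |v|²}. -/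
open MeasureTheory Real Filter Topology
open scoped RealInnerProductSpace

noncomputable section

/-- A continuous solution of Jensen's equation on `ℝ` is affine. -/
lemma eq_affine_of_jensen {w : ℝ → ℝ} (hw : Continuous w)
    (h : ∀ t s, w (t + s) + w (t - s) = 2 * w t) (t : ℝ) :
    w t = w 0 + t * (w 1 - w 0) := by
  let φ : ℝ →+ ℝ :=
    { toFun := fun t => w t - w 0
      map_zero' := sub_self _
      map_add' := fun a b => by
        have h1 := h ((a + b) / 2) ((a - b) / 2)
        have h2 := h ((a + b) / 2) ((a + b) / 2)
        rw [show (a + b) / 2 + (a - b) / 2 = a by ring,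
          show (a + b) / 2 - (a - b) / 2 = b by ring] at h1
        rw [add_halves, sub_self] at h2
        linarith }
  have hφ : Continuous φ := hw.sub continuous_const
  have := map_real_smul φ hφ t 1
  simp only [smul_eq_mul, mul_one] at this
  change w t - w 0 = t * (w 1 - w 0) at this
  linarith

/-- A `C¹` function on `ℝ` whose symmetric second differences do not depend on the centre is a
polynomial of degree at most two. -/
lemma exists_eq_quadratic_of_second_difference {u q : ℝ → ℝ} (hu : ContDiff ℝ 1 u)
    (h : ∀ t s, u (t + s) + u (t - s) - 2 * u t = q s) :
    ∃ b c : ℝ, ∀ t, u t = u 0 + b * t + c * t ^ 2 := by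
  have hd : Differentiable ℝ u := hu.differentiable one_ne_zero
  have hJ : ∀ t s, deriv u (t + s) + deriv u (t - s) = 2 * deriv u t := fun t s => by
    have h1 : HasDerivAt (fun t => u (t + s) + u (t - s) - 2 * u t)
        (deriv u (t + s) + deriv u (t - s) - 2 * deriv u t) t :=
      ((hd _).hasDerivAt.comp_add_const t s).add ((hd _).hasDerivAt.comp_sub_const t s)
        |>.sub ((hd t).hasDerivAt.const_mul 2)
    have h2 : HasDerivAt (fun t => u (t + s) + u (t - s) - 2 * u t) 0 t := by
      simp only [h]
      exact hasDerivAt_const t (q s)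
    linarith [h1.unique h2]
  have haff := eq_affine_of_jensen (hu.continuous_deriv le_rfl) hJ
  refine ⟨deriv u 0, (deriv u 1 - deriv u 0) / 2, fun t => ?_⟩
  have hz : ∀ t, HasDerivAt
      (fun t => u t - (deriv u 0 * t + (deriv u 1 - deriv u 0) / 2 * t ^ 2)) 0 t := fun t => by
    have h1 := (hd t).hasDerivAt.sub (((hasDerivAt_id t).const_mul (deriv u 0)).add
      ((hasDerivAt_pow 2 t).const_mul ((deriv u 1 - deriv u 0) / 2)))
    refine h1.congr_deriv ?_
    rw [haff t]
    norm_num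
    ring
  have := is_const_of_deriv_eq_zero (fun t => (hz t).differentiableAt) (fun t => (hz t).deriv) t 0
  simp at this
  linarith

/-- A collision invariant takes equal diagonal sums on every rectangle. -/
lemma add_eq_add_of_inner_eq_zero {d : ℕ} {f : Rd d → ℝ}
    (h : ∀ v vs ω, collDiff d f v vs ω = 0) (a x y : Rd d) (hxy : ⟪x, y⟫ = 0) :
    f (a + x + y) + f a = f (a + x) + f (a + y) := by
  rcases eq_or_ne y 0 with rfl | hy
  · simp
  have hy' : ‖y‖ ≠ 0 := norm_ne_zero_iff.2 hy
  have key := h (a + x + y) a ⟨‖y‖⁻¹ • y, by simp [norm_smul, hy']⟩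
  have hs : ⟪a + x + y - a, ‖y‖⁻¹ • y⟫ • (‖y‖⁻¹ • y) = y := by
    rw [show a + x + y - a = x + y by abel, inner_smul_right, inner_add_left, hxy,
      real_inner_self_eq_norm_sq, smul_smul]
    rw [zero_add, show ‖y‖⁻¹ * ‖y‖ ^ 2 * ‖y‖⁻¹ = 1 by field_simp, one_smul]
  simp only [collDiff, vOut, vsOut, hs, add_sub_cancel_right] at key
  linarith

/-- A `C¹` collision invariant is a linear combination of the elementary ones. -/
lemma exists_eq_quadratic_of_collDiff_eq_zero {d : ℕ} (hd : 2 ≤ d) {f : Rd d → ℝ}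
    (hf : ContDiff ℝ 1 f) (h : ∀ v vs ω, collDiff d f v vs ω = 0) :
    ∃ (a : ℝ) (b : Rd d) (c : ℝ), ∀ v, f v = a + ⟪b, v⟫ + c * ‖v‖ ^ 2 := by
  have hrect := add_eq_add_of_inner_eq_zero h
  let e : Fin d → ℝ → Rd d := fun i t => EuclideanSpace.single i t
  have he : ∀ i s t, e i (s + t) = e i s + e i t := fun i s t => by
    ext k; by_cases hk : k = i <;> simp [e, hk]
  have hen : ∀ i t, e i (-t) = -e i t := fun i t => by
    ext k; by_cases hk : k = i <;> simp [e, hk]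
  have horth : ∀ i j s t, i ≠ j → ⟪e i s, e j t⟫ = 0 := fun i j s t hij => by
    simp [e, EuclideanSpace.inner_single_left, hij]
  have hpair : ∀ i j s t, i ≠ j → f (e i s + e j t) = f (e i s) + f (e j t) - f 0 := by
    intro i j s t hij
    have := hrect 0 (e i s) (e j t) (horth i j s t hij)
    simp only [zero_add] at this
    linarith
  have hdiff : ∀ i j, i ≠ j → ∀ t r s,
      f (e i (t + s)) + f (e i (t - s)) - 2 * f (e i t)
        = f (e j (r + s)) + f (e j (r - s)) - 2 * f (e j r) := by
    intro i j hij t r s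
    have h1 := hrect (e i (t - s) + e j r) (e i s + e j s) (e i s - e j s) (by
      simp [inner_add_left, inner_sub_right, horth i j _ _ hij, horth j i _ _ hij.symm]
      simp [e])
    rw [show e i (t - s) + e j r + (e i s + e j s) + (e i s - e j s) = e i (t + s) + e j r by
        simp only [sub_eq_add_neg, he, hen]; abel,
      show e i (t - s) + e j r + (e i s + e j s) = e i t + e j (r + s) by
        simp only [sub_eq_add_neg, he, hen]; abel,
      show e i (t - s) + e j r + (e i s - e j s) = e i t + e j (r - s) by
        simp only [sub_eq_add_neg, he, hen]; abel] at h1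
    simp only [hpair i j _ _ hij] at h1
    linarith
  have he0 : ∀ i, e i 0 = 0 := fun i => by simp [e]
  have hquad : ∀ i, ∃ b c : ℝ, ∀ t, f (e i t) = f 0 + b * t + c * t ^ 2 := by
    intro i
    have : Nontrivial (Fin d) := Fin.nontrivial_iff_two_le.2 hd
    obtain ⟨j, hj⟩ := exists_ne i
    have hu : ContDiff ℝ 1 (fun t => f (e i t)) := by
      refine hf.comp ?_
      rw [contDiff_euclidean]
      intro k
      by_cases hk : k = i
      · subst hk; simp only [e, PiLp.single_apply, if_pos]; exact contDiff_id
      · simpa [e, hk] using contDiff_const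
    have := exists_eq_quadratic_of_second_difference hu (fun t s => hdiff i j hj.symm t 0 s)
    simpa only [he0] using this
  choose b c hbc using hquad
  have hc : ∀ i j, c i = c j := by
    intro i j
    rcases eq_or_ne i j with rfl | hij
    · rfl
    have := hdiff i j hij 0 0 1
    simp only [hbc] at this
    linarith
  have hsum : ∀ (v : Rd d) (s : Finset (Fin d)),
      f (∑ i ∈ s, e i (v i)) = f 0 + ∑ i ∈ s, (f (e i (v i)) - f 0) := by
    intro v s
    induction s using Finset.induction_on with
    | empty => simp
    | insert i s hi ih =>
      rw [Finset.sum_insert hi, Finset.sum_insert hi]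
      have := hrect 0 (e i (v i)) (∑ k ∈ s, e k (v k)) (by
        rw [inner_sum]
        exact Finset.sum_eq_zero fun k hk => horth i k _ _ fun hik => hi (hik ▸ hk))
      simp only [zero_add] at this
      linarith
  refine ⟨f 0, WithLp.toLp 2 b, c ⟨0, by omega⟩, fun v => ?_⟩
  have hv : v = ∑ i, e i (v i) := by
    ext k
    simp [e, Pi.single_apply]
  conv_lhs => rw [hv, hsum]
  rw [EuclideanSpace.real_norm_sq_eq, Finset.mul_sum, PiLp.inner_apply, add_assoc,
    ← Finset.sum_add_distrib]
  congr 1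
  refine Finset.sum_congr rfl fun i _ => ?_
  rw [hbc, hc i ⟨0, by omega⟩]
  simp
  ring

/-- Functions that are square integrable against `(1 + |v|) M(v) dv` are locally integrable. -/
lemma locallyIntegrable_of_integrable_sq_mul_maxw {d : ℕ} {g : Rd d → ℝ} (hmeas : AEMeasurable g)
    (hL2 : Integrable (fun v => (1 + ‖v‖) * g v ^ 2 * Maxw d v)) : LocallyIntegrable g := by
  rw [locallyIntegrable_iff]
  intro K hK
  obtain ⟨R, hR⟩ := hK.isBounded.exists_norm_le
  set m : ℝ := (2 * π) ^ (-(d : ℝ) / 2) * Real.exp (-R ^ 2 / 2) with hm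
  have hmpos : 0 < m := by positivity
  have hint : IntegrableOn (fun v => 1 + m⁻¹ * ((1 + ‖v‖) * g v ^ 2 * Maxw d v)) K :=
    (integrableOn_const hK.measure_lt_top.ne).add (hL2.integrableOn.const_mul _)
  refine hint.mono' hmeas.aestronglyMeasurable.restrict ?_
  filter_upwards [ae_restrict_mem hK.measurableSet] with v hv
  have hM : m ≤ Maxw d v := by
    have := hR v hv
    have := pow_le_pow_left₀ (norm_nonneg v) this 2
    exact mul_le_mul_of_nonneg_left (Real.exp_le_exp.2 (by linarith)) (by positivity)
  have h1 : m * g v ^ 2 ≤ (1 + ‖v‖) * g v ^ 2 * Maxw d v := by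
    have := norm_nonneg v
    calc m * g v ^ 2 ≤ Maxw d v * g v ^ 2 := by gcongr
      _ ≤ (1 + ‖v‖) * (Maxw d v * g v ^ 2) := by
        have : 0 ≤ Maxw d v * g v ^ 2 := mul_nonneg (hmpos.le.trans hM) (sq_nonneg _)
        nlinarith
      _ = _ := by ring
  have h2 : g v ^ 2 ≤ m⁻¹ * ((1 + ‖v‖) * g v ^ 2 * Maxw d v) := by
    rw [inv_mul_eq_div, le_div_iff₀ hmpos]
    linarith
  rw [Real.norm_eq_abs]
  nlinarith [sq_abs (g v), sq_nonneg (|g v| - 1), abs_nonneg (g v)]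

lemma collDiff_continuous {d : ℕ} {f : Rd d → ℝ} (hf : Continuous f) :
    Continuous fun p : (Rd d × Rd d) × Sph d => collDiff d f p.1.1 p.1.2 p.2 := by
  unfold collDiff vOut vsOut
  fun_prop

/-- The convolution of an almost everywhere collision invariant with a continuous compactly
supported function is a collision invariant. -/
lemma collDiff_convolution_eq_zero {d : ℕ} {g φ : Rd d → ℝ} (hg : LocallyIntegrable g)
    (hnull : ∀ᵐ p : (Rd d × Rd d) × Sph d
        ∂(((volume : Measure (Rd d)).prod (volume : Measure (Rd d))).prod (sphMeasure d)),
      collDiff d g p.1.1 p.1.2 p.2 = 0)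
    (hφ : Continuous φ) (hφc : HasCompactSupport φ) (v vs : Rd d) (ω : Sph d) :
    collDiff d (convolution φ g (ContinuousLinearMap.lsmul ℝ ℝ) volume) v vs ω = 0 := by
  have : IsFiniteMeasure (sphMeasure d) := by unfold sphMeasure; infer_instance
  have : (sphMeasure d).IsOpenPosMeasure := by unfold sphMeasure; infer_instance
  have : SFinite (sphMeasure d) := inferInstance
  have : SFinite (((volume : Measure (Rd d)).prod (volume : Measure (Rd d))).prod
      (sphMeasure d)) := inferInstance
  have : Measure.IsOpenPosMeasure (((volume : Measure (Rd d)).prod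
      (volume : Measure (Rd d))).prod (sphMeasure d)) := inferInstance
  set μ := ((volume : Measure (Rd d)).prod (volume : Measure (Rd d))).prod (sphMeasure d)
  set F := convolution φ g (ContinuousLinearMap.lsmul ℝ ℝ) volume
  have hex : ConvolutionExists φ g (ContinuousLinearMap.lsmul ℝ ℝ) volume :=
    hφc.convolutionExists_left _ hφ hg
  have hFc : Continuous F := hφc.continuous_convolution_left _ hφ hg
  have hshift : Measure.QuasiMeasurePreserving
      (fun z : ((Rd d × Rd d) × Sph d) × Rd d =>
        (((z.1.1.1 - z.2, z.1.1.2 - z.2), z.1.2) : (Rd d × Rd d) × Sph d))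
      (μ.prod volume) μ := by
    refine QuasiMeasurePreserving.prod_of_left (by fun_prop) (ae_of_all _ fun t => ?_)
    exact (((measurePreserving_sub_right volume t).prod
      (measurePreserving_sub_right volume t)).prod (MeasurePreserving.id _)).quasiMeasurePreserving
  have hae := Measure.ae_ae_of_ae_prod (hshift.ae hnull)
  have hzero : (fun p : (Rd d × Rd d) × Sph d => collDiff d F p.1.1 p.1.2 p.2)
      =ᵐ[μ] fun _ => 0 := by
    filter_upwards [hae] with p hp
    obtain ⟨⟨v, vs⟩, ω⟩ := p
    have hout : ∀ t, vOut d (v - t) (vs - t) ω = vOut d v vs ω - t := fun t => by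
      simp only [vOut, sub_sub_sub_cancel_right]; abel
    have hsout : ∀ t, vsOut d (v - t) (vs - t) ω = vsOut d v vs ω - t := fun t => by
      simp only [vsOut, sub_sub_sub_cancel_right]; abel
    have hi : ∀ x, Integrable fun t => φ t * g (x - t) := fun x => (hex x).integrable
    have hFx : ∀ x, F x = ∫ t, φ t * g (x - t) := fun x => rfl
    simp only [collDiff, hFx]
    have hi₂ : Integrable fun t =>
        φ t * g (vOut d v vs ω - t) + φ t * g (vsOut d v vs ω - t) := (hi _).add (hi _)
    have hi₃ : Integrable fun t =>
        φ t * g (vOut d v vs ω - t) + φ t * g (vsOut d v vs ω - t) - φ t * g (v - t) :=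
      hi₂.sub (hi _)
    rw [← integral_add (hi _) (hi _), ← integral_sub hi₂ (hi _), ← integral_sub hi₃ (hi _)]
    refine integral_eq_zero_of_ae ?_
    filter_upwards [hp] with t ht
    simp only [collDiff, hout, hsout] at ht
    simp only [Pi.zero_apply]
    linear_combination φ t * ht
  exact congrFun (((collDiff_continuous hFc).ae_eq_iff_eq μ continuous_const).1 hzero)
    ((v, vs), ω)

/-- The quadratic functions `v ↦ a + b·v + c|v|²` restricted to a set form a closed set for
pointwise convergence. -/
lemma exists_eq_quadratic_of_tendsto {d : ℕ} {S : Set (Rd d)} {F : ℕ → Rd d → ℝ} {g : Rd d → ℝ}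
    (hF : ∀ n, ∃ (a : ℝ) (b : Rd d) (c : ℝ), ∀ v, F n v = a + ⟪b, v⟫ + c * ‖v‖ ^ 2)
    (hlim : ∀ v ∈ S, Tendsto (fun n => F n v) atTop (𝓝 (g v))) :
    ∃ (a : ℝ) (b : Rd d) (c : ℝ), ∀ v ∈ S, g v = a + ⟪b, v⟫ + c * ‖v‖ ^ 2 := by
  let T : (ℝ × Rd d × ℝ) →ₗ[ℝ] (S → ℝ) :=
    { toFun := fun p v => p.1 + ⟪p.2.1, v⟫ + p.2.2 * ‖(v : Rd d)‖ ^ 2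
      map_add' := fun p q => by
        ext v
        simp only [Prod.fst_add, Prod.snd_add, inner_add_left, Pi.add_apply]
        ring
      map_smul' := fun r p => by
        ext v
        simp only [Prod.smul_fst, Prod.smul_snd, real_inner_smul_left, smul_eq_mul,
          RingHom.id_apply, Pi.smul_apply]
        ring }
  have hcl : IsClosed (LinearMap.range T : Set (S → ℝ)) :=
    Submodule.closed_of_finiteDimensional _
  have hmem : (fun v : S => g v) ∈ (LinearMap.range T : Set (S → ℝ)) := by
    refine hcl.mem_of_tendsto (f := fun n (v : S) => F n v) (b := atTop)
      (tendsto_pi_nhds.2 fun v => hlim v v.2) (Eventually.of_forall fun n => ?_)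
    obtain ⟨a, b, c, habc⟩ := hF n
    exact ⟨(a, b, c), funext fun v => (habc v).symm⟩
  obtain ⟨⟨a, b, c⟩, habc⟩ := hmem
  exact ⟨a, b, c, fun v hv => (congrFun habc ⟨v, hv⟩).symm⟩

/-- characterization of the nullspace of `ℒ`: if
`g ∈ L²((1+|v|) M dv)` satisfies `Δg = 0` almost everywhere, then
`g(v) = a + b·v + c|v|²` almost everywhere; i.e. the nullspace of the hard-sphere
linearized Boltzmann collision operator is exactly `span{1, v_1, …, v_d, |v|²}`. -/
theorem nullspace_of_collision_operator (d : ℕ) (hd : 2 ≤ d)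
    (g : Rd d → ℝ) (hmeas : AEMeasurable g)
    (hL2 : Integrable (fun v => (1 + ‖v‖) * g v ^ 2 * Maxw d v))
    (hnull : ∀ᵐ p : (Rd d × Rd d) × Sph d
        ∂(((volume : Measure (Rd d)).prod (volume : Measure (Rd d))).prod
            (sphMeasure d)),
      collDiff d g p.1.1 p.1.2 p.2 = 0) :
    ∃ (a : ℝ) (b : Rd d) (c : ℝ),
      g =ᵐ[(volume : Measure (Rd d))] fun v => a + ⟪b, v⟫ + c * ‖v‖ ^ 2 := by
  have hloc := locallyIntegrable_of_integrable_sq_mul_maxw hmeas hL2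
  let φ : ℕ → ContDiffBump (0 : Rd d) := fun n =>
    ⟨1 / ((n : ℝ) + 1), 2 * (1 / ((n : ℝ) + 1)), by positivity,
      by linarith [show (0 : ℝ) < 1 / ((n : ℝ) + 1) by positivity]⟩
  have hφ : Tendsto (fun n => (φ n).rOut) atTop (𝓝 0) := by
    simpa only [mul_zero] using tendsto_one_div_add_atTop_nhds_zero_nat.const_mul (2 : ℝ)
  have hlim := ContDiffBump.ae_convolution_tendsto_right_of_locallyIntegrable (K := 2)
    (μ := (volume : Measure (Rd d))) hφ
    (Eventually.of_forall fun n => le_rfl) hloc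
  obtain ⟨a, b, c, habc⟩ := exists_eq_quadratic_of_tendsto (S := {v | Tendsto
    (fun n => convolution ((φ n).normed volume) g (ContinuousLinearMap.lsmul ℝ ℝ) volume v)
    atTop (𝓝 (g v))}) (fun n =>
    exists_eq_quadratic_of_collDiff_eq_zero hd
      ((φ n).hasCompactSupport_normed.contDiff_convolution_left (n := 1) _
        (φ n).contDiff_normed hloc)
      (collDiff_convolution_eq_zero hloc hnull (φ n).continuous_normed
        (φ n).hasCompactSupport_normed)) (fun v hv => hv)
  exact ⟨a, b, c, hlim.mono fun v hv => habc v hv⟩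

end
end
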